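/- arXiv:1501.06865 — 2 statements merged into one kernel-verified Lean document; each statement's English description precedes it below -/
import Mathlib

section
/- Let d ≥ 1, ρ ∈ (0,1), W ∈ S_{2,ρ}(ℝ^d), and let η = η₀ + η̃ be admissible with mean value η₀ = 0. Then there exist a constant C ∈ (0,∞) and E₀ < 0 such that N(E; ηW) ≤ C|E|^{(d/2)(1 - 1/ρ)} for all E ∈ (E₀, 0). -/
open MeasureTheory Filter Real Set Topology

noncomputable section

abbrev Ed (d : ℕ) := EuclideanSpace ℝ (Fin d)

/-- Glazman variational count of eigenvalues of `-Δ + V` below `E`. -/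
noncomputable def schN (d : ℕ) (V : Ed d → ℝ) (E : ℝ) : ℕ∞ :=
  ⨆ F : {F : Submodule ℝ (Ed d → ℝ) //
      (∀ u ∈ F, ContDiff ℝ (⊤ : ℕ∞) u ∧ HasCompactSupport u) ∧
      (∀ u ∈ F, u ≠ 0 →
        (∫ x, (‖gradient u x‖ ^ 2 + V x * u x ^ 2)) < E * ∫ x, u x ^ 2)},
    (Module.finrank ℝ F.1 : ℕ∞)

/-- Laplacian. -/
noncomputable def lap (d : ℕ) (φ : Ed d → ℝ) (x : Ed d) : ℝ :=
  ∑ i : Fin d, iteratedFDeriv ℝ 2 φ x ![EuclideanSpace.single i 1, EuclideanSpace.single i 1]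

/-- The symbol class `S_{m,ρ}`. -/
def SClass (d m : ℕ) (ρ : ℝ) (W : Ed d → ℝ) : Prop :=
  ContDiff ℝ m W ∧ ∃ C : ℝ, 0 < C ∧ ∀ k : ℕ, k ≤ m → ∀ x : Ed d,
    ‖iteratedFDeriv ℝ k W x‖ ≤ C * (1 + ‖x‖) ^ (-ρ - (k : ℝ))

/-- The cube `(-R/2, R/2)^d`. -/
def cube (d : ℕ) (R : ℝ) : Set (Ed d) := {x | ∀ i, |x i| < R / 2}

/-- Admissibility of `η` with mean value `η₀` witnessed by the solution `φ` of `Δφ = η - η₀`. -/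
structure IsAdmissible (d : ℕ) (η : Ed d → ℝ) (η₀ : ℝ) (φ : Ed d → ℝ) : Prop where
  background_ne : ∃ x, η x ≠ η₀
  smooth : ContDiff ℝ 2 φ
  bounded : ∀ k : ℕ, k ≤ 2 → ∃ M : ℝ, ∀ x, ‖iteratedFDeriv ℝ k φ x‖ ≤ M
  poisson : ∀ x, lap d φ x = η x - η₀
  normalized : Filter.limsup (fun R : ℝ => (∫ x in cube d R, φ x) / R ^ d) Filter.atTop = 0

/-- Volume of the unit ball of `ℝ^d`. -/
noncomputable def tau (d : ℕ) : ℝ := (volume (Metric.ball (0 : Ed d) 1)).toReal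

/-- Semiclassical counting function. -/
noncomputable def Ncl (d : ℕ) (V : Ed d → ℝ) (E : ℝ) : ℝ :=
  (tau d / (2 * π) ^ d) * ∫ x, (max (E - V x) 0) ^ ((d : ℝ) / 2)



open scoped ENNReal

/-- Affine contraction towards a point of a convex set: change of variables bound. -/
lemma aux_contract (d : ℕ) (Q : Set (Ed d)) (hQ : Convex ℝ Q) (hQm : MeasurableSet Q)
    (G : Ed d → ℝ≥0∞) (hG : Measurable G) (y : Ed d) (hy : y ∈ Q) (t : ℝ)
    (ht0 : 0 ≤ t) (ht : t ≤ 1 / 2) :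
    ∫⁻ x in Q, G ((1 - t) • x + t • y) ≤ 2 ^ d * ∫⁻ x in Q, G x := by
  have h1 : ∫⁻ x in Q, G ((1 - t) • x + t • y)
      ≤ ∫⁻ x, (Q.indicator G) ((1 - t) • x + t • y) := by
    rw [← lintegral_indicator hQm]
    apply lintegral_mono
    intro x
    by_cases hx : x ∈ Q
    · have : (1 - t) • x + t • y ∈ Q := hQ hx hy (by linarith) ht0 (by ring)
      simp [hx, this]
    · simp [hx]
  have hI : Measurable (Q.indicator G) := hG.indicator hQm
  have hne : (1 - t) ≠ 0 := by linarith
  have h2 : ∫⁻ x, (Q.indicator G) ((1 - t) • x + t • y)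
      = ENNReal.ofReal |((1 - t) ^ d)⁻¹| * ∫⁻ x in Q, G x := by
    have hm := Measure.map_addHaar_smul (volume : Measure (Ed d)) hne
    have h3 : ∫⁻ x, (Q.indicator G) ((1 - t) • x + t • y)
        = ∫⁻ z, (Q.indicator G) (z + t • y) ∂(Measure.map (fun x => (1 - t) • x) volume) := by
      rw [lintegral_map (f := fun z => (Q.indicator G) (z + t • y))
        (hI.comp (measurable_add_const _)) (measurable_const_smul _)]
    rw [h3, hm, lintegral_smul_measure, lintegral_add_right_eq_self (Q.indicator G) (t • y),
      lintegral_indicator hQm]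
    simp
  refine h1.trans (h2.le.trans ?_)
  gcongr
  have : |((1 - t) ^ d)⁻¹| ≤ 2 ^ d := by
    rw [abs_of_nonneg (by have : 0 ≤ 1 - t := by linarith
                          positivity), ← inv_pow]
    have h0 : 0 < 1 - t := by linarith
    refine pow_le_pow_left₀ (by positivity) ?_ d
    rw [inv_le_comm₀ h0 (by norm_num)]
    linarith
  calc ENNReal.ofReal |((1 - t) ^ d)⁻¹| ≤ ENNReal.ofReal (2 ^ d) := ENNReal.ofReal_le_ofReal this
    _ = 2 ^ d := by rw [ENNReal.ofReal_pow (by norm_num)]; simp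

/-- Jensen on the unit interval. -/
lemma aux_jensen (h : ℝ → ℝ) (hc : Continuous h) :
    (∫ t in (0 : ℝ)..1, h t) ^ 2 ≤ ∫ t in (0 : ℝ)..1, h t ^ 2 := by
  set m := ∫ t in (0 : ℝ)..1, h t with hm
  have h0 : 0 ≤ ∫ t in (0 : ℝ)..1, (h t - m) ^ 2 :=
    intervalIntegral.integral_nonneg (by norm_num) (fun t _ => sq_nonneg _)
  have h1 : ∫ t in (0 : ℝ)..1, (h t - m) ^ 2
      = (∫ t in (0 : ℝ)..1, h t ^ 2) - 2 * m * m + m ^ 2 := by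
    have : ∀ t, (h t - m) ^ 2 = h t ^ 2 - 2 * m * h t + m ^ 2 := fun t => by ring
    simp only [this]
    rw [intervalIntegral.integral_add, intervalIntegral.integral_sub,
      intervalIntegral.integral_const_mul, ← hm]
    · simp
    all_goals exact Continuous.intervalIntegrable (by fun_prop) _ _
  nlinarith

/-- Pointwise difference bound. -/
lemma aux_diff (d : ℕ) (u : Ed d → ℝ) (hu : ContDiff ℝ 1 u) (x y : Ed d) (δ : ℝ)
    (hxy : ‖y - x‖ ≤ δ) :
    ENNReal.ofReal ((u x - u y) ^ 2) ≤ ENNReal.ofReal (δ ^ 2) *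
      ∫⁻ t in Icc (0 : ℝ) 1, ENNReal.ofReal (‖fderiv ℝ u ((1 - t) • x + t • y)‖ ^ 2) := by
  have hfc : Continuous (fderiv ℝ u) := hu.continuous_fderiv (by norm_num)
  have hd : ∀ t : ℝ, HasDerivAt (fun t : ℝ => u ((1 - t) • x + t • y))
      (fderiv ℝ u ((1 - t) • x + t • y) (y - x)) t := by
    intro t
    have h1 : HasDerivAt (fun t : ℝ => (1 - t) • x + t • y) (y - x) t := by
      have h2 := (((hasDerivAt_id t).const_sub 1).smul_const x).add
        ((hasDerivAt_id t).smul_const y)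
      refine h2.congr_deriv ?_
      simp [sub_eq_add_neg, add_comm]
    exact ((hu.differentiable (by norm_num)) _).hasFDerivAt.comp_hasDerivAt t h1
  have hcont : Continuous (fun t : ℝ => fderiv ℝ u ((1 - t) • x + t • y) (y - x)) := by
    fun_prop
  have hftc := intervalIntegral.integral_eq_sub_of_hasDerivAt (a := 0) (b := 1)
    (fun t _ => hd t) (hcont.intervalIntegrable _ _)
  simp only [sub_zero, one_smul, zero_smul, add_zero, sub_self, zero_add] at hftc
  have hj := aux_jensen _ hcont
  rw [hftc] at hj
  have hle : ∫ t in (0 : ℝ)..1, (fderiv ℝ u ((1 - t) • x + t • y) (y - x)) ^ 2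
      ≤ ∫ t in (0 : ℝ)..1, δ ^ 2 * ‖fderiv ℝ u ((1 - t) • x + t • y)‖ ^ 2 := by
    apply intervalIntegral.integral_mono_on (by norm_num)
    · exact Continuous.intervalIntegrable (by fun_prop) _ _
    · exact Continuous.intervalIntegrable (by fun_prop) _ _
    · intro t _
      have h1 := (fderiv ℝ u ((1 - t) • x + t • y)).le_opNorm (y - x)
      have h2 : |fderiv ℝ u ((1 - t) • x + t • y) (y - x)|
          ≤ ‖fderiv ℝ u ((1 - t) • x + t • y)‖ * δ :=
        h1.trans (by gcongr)
      calc _ = |fderiv ℝ u ((1 - t) • x + t • y) (y - x)| ^ 2 := by rw [sq_abs]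
        _ ≤ (‖fderiv ℝ u ((1 - t) • x + t • y)‖ * δ) ^ 2 := by gcongr
        _ = _ := by ring
  rw [intervalIntegral.integral_const_mul] at hle
  have hcg : Continuous (fun t : ℝ => ‖fderiv ℝ u ((1 - t) • x + t • y)‖ ^ 2) := by fun_prop
  rw [← ofReal_integral_eq_lintegral_ofReal
    (hcg.continuousOn.integrableOn_compact isCompact_Icc) (ae_of_all _ fun t => by positivity),
    ← ENNReal.ofReal_mul (by positivity)]
  apply ENNReal.ofReal_le_ofReal
  rw [integral_Icc_eq_integral_Ioc, ← intervalIntegral.integral_of_le (by norm_num)]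
  calc (u x - u y) ^ 2 = (u y - u x) ^ 2 := by ring
    _ ≤ _ := hj.trans hle

/-- Poincaré inequality on bounded convex sets. -/
lemma aux_poincare (d : ℕ) (Q : Set (Ed d)) (hQ : Convex ℝ Q) (hQm : MeasurableSet Q)
    (hQf : volume Q ≠ ⊤) (δ : ℝ) (hδ : ∀ x ∈ Q, ∀ y ∈ Q, ‖y - x‖ ≤ δ)
    (u : Ed d → ℝ) (hu : ContDiff ℝ 1 u) (hs : HasCompactSupport u)
    (h0 : ∫ x in Q, u x = 0) :
    ∫ x in Q, u x ^ 2 ≤ 2 ^ d * δ ^ 2 * ∫ x in Q, ‖fderiv ℝ u x‖ ^ 2 := by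
  have hfc : Continuous (fderiv ℝ u) := hu.continuous_fderiv (by norm_num)
  have huc : Continuous u := hu.continuous
  have hGi : Integrable (fun x => ‖fderiv ℝ u x‖ ^ 2) (volume : Measure (Ed d)) := by
    apply Continuous.integrable_of_hasCompactSupport (by fun_prop)
    exact (hs.fderiv (𝕜 := ℝ)).comp_left (g := fun z => ‖z‖ ^ 2) (by simp)
  have hui : Integrable u (volume : Measure (Ed d)) := huc.integrable_of_hasCompactSupport hs
  have hu2i : Integrable (fun x => u x ^ 2) (volume : Measure (Ed d)) := by
    apply Continuous.integrable_of_hasCompactSupport (by fun_prop)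
    exact hs.comp_left (g := fun z => z ^ 2) (by simp)
  set G : Ed d → ℝ≥0∞ := fun x => ENNReal.ofReal (‖fderiv ℝ u x‖ ^ 2) with hGdef
  have hG : Measurable G := by
    exact ENNReal.measurable_ofReal.comp (Continuous.measurable (by fun_prop))
  have : IsFiniteMeasure ((volume : Measure (Ed d)).restrict Q) :=
    ⟨by simpa using lt_top_iff_ne_top.2 hQf⟩
  set μ := (volume : Measure (Ed d)).restrict Q with hμ
  set I := ∫ x, u x ^ 2 ∂μ with hI
  set J := ∫ x, ‖fderiv ℝ u x‖ ^ 2 ∂μ with hJ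
  set V := μ.real univ with hV
  have hI0 : 0 ≤ I := integral_nonneg fun x => sq_nonneg _
  have hJ0 : 0 ≤ J := integral_nonneg fun x => sq_nonneg _
  have hu2i' : Integrable (fun x => u x ^ 2) μ := hu2i.restrict
  have hui' : Integrable u μ := hui.restrict
  -- left side
  have hL : ∫⁻ x, ∫⁻ y, ENNReal.ofReal ((u x - u y) ^ 2) ∂μ ∂μ = ENNReal.ofReal (2 * V * I) := by
    have h1 : ∀ x, ∫⁻ y, ENNReal.ofReal ((u x - u y) ^ 2) ∂μ
        = ENNReal.ofReal (V * u x ^ 2 + I) := by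
      intro x
      have he : ∀ y, (u x - u y) ^ 2 = u x ^ 2 - 2 * u x * u y + u y ^ 2 := fun y => by ring
      have hi : Integrable (fun y => u x ^ 2 - 2 * u x * u y) μ :=
        (integrable_const _).sub (hui'.const_mul _)
      rw [← ofReal_integral_eq_lintegral_ofReal _ (ae_of_all _ fun y => sq_nonneg _)]
      · congr 1
        simp only [he]
        rw [integral_add hi hu2i', integral_sub (integrable_const _) (hui'.const_mul _),
          integral_const_mul, h0]
        simp [hV, hI]
      · simp only [he]
        exact hi.add hu2i'
    simp only [h1]
    rw [← ofReal_integral_eq_lintegral_ofReal]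
    · congr 1
      rw [integral_add (hu2i'.const_mul _) (integrable_const _), integral_const_mul]
      simp [← hV, ← hI]
      ring
    · exact (hu2i'.const_mul _).add (integrable_const _)
    · refine ae_of_all _ fun x => ?_
      have : 0 ≤ V := measureReal_nonneg
      simp only [Pi.zero_apply]
      positivity
  have hJl : ∫⁻ x, G x ∂μ = ENNReal.ofReal J :=
    (ofReal_integral_eq_lintegral_ofReal hGi.restrict (ae_of_all _ fun x => by positivity)).symm
  have hVl : μ univ = ENNReal.ofReal V := by simp [hV]
  -- for each t
  have hT : ∀ t ∈ Icc (0 : ℝ) 1, ∫⁻ x, ∫⁻ y, G ((1 - t) • x + t • y) ∂μ ∂μ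
      ≤ μ univ * (2 ^ d * ∫⁻ x, G x ∂μ) := by
    intro t ht
    rcases le_total t (1 / 2) with h | h
    · rw [lintegral_lintegral_swap]
      · calc ∫⁻ y, ∫⁻ x, G ((1 - t) • x + t • y) ∂μ ∂μ
            ≤ ∫⁻ y, (2 ^ d * ∫⁻ x, G x ∂μ) ∂μ := by
              apply setLIntegral_mono' hQm
              intro y hy
              exact aux_contract d Q hQ hQm G hG y hy t ht.1 h
          _ = _ := by rw [lintegral_const, mul_comm]
      · apply Measurable.aemeasurable
        apply hG.comp
        fun_prop
    · calc ∫⁻ x, ∫⁻ y, G ((1 - t) • x + t • y) ∂μ ∂μ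
            ≤ ∫⁻ y, (2 ^ d * ∫⁻ x, G x ∂μ) ∂μ := by
              apply setLIntegral_mono' hQm
              intro y hy
              have := aux_contract d Q hQ hQm G hG y hy (1 - t) (by linarith [ht.2]) (by linarith)
              simpa [add_comm] using this
          _ = _ := by rw [lintegral_const, mul_comm]
  have hR : ∫⁻ x, ∫⁻ y, ENNReal.ofReal ((u x - u y) ^ 2) ∂μ ∂μ ≤
      ENNReal.ofReal (δ ^ 2) * (μ univ * (2 ^ d * ∫⁻ x, G x ∂μ)) := by
    have hmeas : Measurable (fun p : (Ed d × ℝ) × Ed d => G ((1 - p.1.2) • p.1.1 + p.1.2 • p.2)) := by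
      apply hG.comp
      fun_prop
    calc ∫⁻ x, ∫⁻ y, ENNReal.ofReal ((u x - u y) ^ 2) ∂μ ∂μ
        ≤ ∫⁻ x, ∫⁻ y, ENNReal.ofReal (δ ^ 2) *
            (∫⁻ t in Icc (0 : ℝ) 1, G ((1 - t) • x + t • y)) ∂μ ∂μ := by
          apply setLIntegral_mono' hQm
          intro x hx
          apply setLIntegral_mono' hQm
          intro y hy
          exact aux_diff d u hu x y δ (hδ x hx y hy)
      _ = ∫⁻ x, ENNReal.ofReal (δ ^ 2) * (∫⁻ t in Icc (0 : ℝ) 1,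
            (∫⁻ y, G ((1 - t) • x + t • y) ∂μ)) ∂μ := by
          apply lintegral_congr
          intro x
          rw [lintegral_const_mul' _ _ ENNReal.ofReal_ne_top]
          congr 1
          rw [lintegral_lintegral_swap]
          apply Measurable.aemeasurable
          apply hG.comp
          fun_prop
      _ = ENNReal.ofReal (δ ^ 2) * ∫⁻ t in Icc (0 : ℝ) 1,
            ∫⁻ x, ∫⁻ y, G ((1 - t) • x + t • y) ∂μ ∂μ := by
          rw [lintegral_const_mul' _ _ ENNReal.ofReal_ne_top]
          congr 1
          rw [lintegral_lintegral_swap]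
          exact (Measurable.lintegral_prod_right' (ν := μ) hmeas).aemeasurable
      _ ≤ ENNReal.ofReal (δ ^ 2) * ∫⁻ t in Icc (0 : ℝ) 1, (μ univ * (2 ^ d * ∫⁻ x, G x ∂μ)) := by
          refine mul_le_mul_right ?_ _
          apply setLIntegral_mono' measurableSet_Icc
          exact hT
      _ = _ := by simp
  rw [hL, hJl, hVl] at hR
  have h2d : (2 : ℝ≥0∞) ^ d = ENNReal.ofReal (2 ^ d) := by
    rw [ENNReal.ofReal_pow (by norm_num)]; simp
  have hV0 : 0 ≤ V := measureReal_nonneg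
  rw [h2d, ← ENNReal.ofReal_mul (by positivity), ← ENNReal.ofReal_mul (by positivity),
    ← ENNReal.ofReal_mul (by positivity), ENNReal.ofReal_le_ofReal_iff (by positivity)] at hR
  rcases hV0.eq_or_lt with hz | hpos
  · have : μ = 0 := by
      rw [← Measure.measure_univ_eq_zero, hVl, ← hz]; simp
    have hIz : I = 0 := by rw [hI, this]; simp
    rw [hIz]; positivity
  · have hp : 0 ≤ 2 ^ d * δ ^ 2 * J := by positivity
    have : V * (2 * I) ≤ V * (2 ^ d * δ ^ 2 * J) := by nlinarith
    have := le_of_mul_le_mul_left this hpos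
    linarith

/-- Half-open cell of side `l` with integer index `j`. -/
def cell (d : ℕ) (l : ℝ) (j : Fin d → ℤ) : Set (Ed d) :=
  ⋂ i, (fun x : Ed d => x i) ⁻¹' (Set.Ico (j i * l) ((j i + 1) * l))

/-- Index set for the grid. -/
def gridIdx (d n : ℕ) : Finset (Fin d → ℤ) :=
  Fintype.piFinset (fun _ => Finset.Ico (-(n : ℤ)) n)

lemma gridIdx_card (d n : ℕ) : (gridIdx d n).card = (2 * n) ^ d := by
  have : ((n : ℤ) + n).toNat = 2 * n := by omega
  simp [gridIdx, this]

lemma cell_meas (d : ℕ) (l : ℝ) (j : Fin d → ℤ) : MeasurableSet (cell d l j) := by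
  refine MeasurableSet.iInter fun i => ?_
  exact (by fun_prop : Measurable (fun x : Ed d => x i)) measurableSet_Ico

lemma cell_convex (d : ℕ) (l : ℝ) (j : Fin d → ℤ) : Convex ℝ (cell d l j) := by
  refine convex_iInter fun i => ?_
  exact (convex_Ico _ _).linear_preimage (EuclideanSpace.proj (𝕜 := ℝ) i).toLinearMap

lemma cell_diam (d : ℕ) (l : ℝ) (hl : 0 < l) (j : Fin d → ℤ) :
    ∀ x ∈ cell d l j, ∀ y ∈ cell d l j, ‖y - x‖ ≤ √d * l := by
  intro x hx y hy
  simp only [cell, mem_iInter, mem_preimage, mem_Ico] at hx hy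
  have h : ‖y - x‖ ^ 2 ≤ (√d * l) ^ 2 := by
    rw [EuclideanSpace.norm_sq_eq, mul_pow, Real.sq_sqrt (by positivity)]
    calc ∑ i, ‖(y - x) i‖ ^ 2 ≤ ∑ i : Fin d, l ^ 2 := by
          apply Finset.sum_le_sum
          intro i _
          have h1 := hx i
          have h2 := hy i
          have : ‖(y - x) i‖ ≤ l := by
            simp only [PiLp.sub_apply, Real.norm_eq_abs, abs_le]
            constructor <;> linarith
          gcongr
      _ = _ := by simp
  exact le_of_sq_le_sq h (by positivity)

lemma cell_finite (d : ℕ) (l : ℝ) (hl : 0 < l) (j : Fin d → ℤ) :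
    volume (cell d l j) ≠ ⊤ := by
  apply ne_of_lt
  apply Bornology.IsBounded.measure_lt_top
  rw [Metric.isBounded_iff]
  refine ⟨√d * l, fun x hx y hy => ?_⟩
  rw [dist_comm, dist_eq_norm]
  exact cell_diam d l hl j x hx y hy

lemma cell_disj (d : ℕ) (l : ℝ) (hl : 0 < l) (j k : Fin d → ℤ) (hjk : j ≠ k) :
    Disjoint (cell d l j) (cell d l k) := by
  rw [Set.disjoint_left]
  intro x hx hy
  apply hjk
  simp only [cell, mem_iInter, mem_preimage, mem_Ico] at hx hy
  funext i
  obtain ⟨a, b⟩ := hx i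
  obtain ⟨a', b'⟩ := hy i
  have h1 : (j i : ℝ) < k i + 1 := lt_of_mul_lt_mul_right (a.trans_lt b') hl.le
  have h2 : (k i : ℝ) < j i + 1 := lt_of_mul_lt_mul_right (a'.trans_lt b) hl.le
  norm_cast at h1 h2
  omega

lemma ball_sub_cells (d : ℕ) (L : ℝ) (n : ℕ) (hL : 0 < L) (hn : 0 < n) :
    Metric.ball (0 : Ed d) L ⊆ ⋃ j ∈ gridIdx d n, cell d (L / n) j := by
  intro x hx
  have hn' : (0 : ℝ) < n := by exact_mod_cast hn
  have hl : 0 < L / n := by positivity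
  rw [mem_ball_zero_iff] at hx
  simp only [mem_iUnion]
  refine ⟨fun i => ⌊x i / (L / n)⌋, ?_, ?_⟩
  · simp only [gridIdx, Fintype.mem_piFinset, Finset.mem_Ico]
    intro i
    have h1 : |x i| < L := (PiLp.norm_apply_le x i).trans_lt hx
    rw [abs_lt] at h1
    rw [Int.le_floor, Int.floor_lt, le_div_iff₀ hl, div_lt_iff₀ hl]
    have : (n : ℝ) * (L / n) = L := by field_simp
    push_cast
    constructor <;> nlinarith
  · simp only [cell, mem_iInter, mem_preimage, mem_Ico]
    intro i
    rw [← le_div_iff₀ hl, ← div_lt_iff₀ hl]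
    exact ⟨Int.floor_le _, Int.lt_floor_add_one _⟩

lemma aux_tile (d : ℕ) (L : ℝ) (n : ℕ) (hL : 0 < L) (hn : 0 < n)
    (u : Ed d → ℝ) (hu : ContDiff ℝ 1 u) (hs : HasCompactSupport u)
    (h0 : ∀ j ∈ gridIdx d n, ∫ x in cell d (L / n) j, u x = 0) :
    ∫ x in Metric.ball (0 : Ed d) L, u x ^ 2 ≤
      2 ^ d * d * (L / n) ^ 2 * ∫ x, ‖fderiv ℝ u x‖ ^ 2 := by
  have hn' : (0 : ℝ) < n := by exact_mod_cast hn
  have hl : 0 < L / n := by positivity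
  have hfc : Continuous (fderiv ℝ u) := hu.continuous_fderiv (by norm_num)
  have huc : Continuous u := hu.continuous
  have hGi : Integrable (fun x => ‖fderiv ℝ u x‖ ^ 2) (volume : Measure (Ed d)) := by
    apply Continuous.integrable_of_hasCompactSupport (by fun_prop)
    exact (hs.fderiv (𝕜 := ℝ)).comp_left (g := fun z => ‖z‖ ^ 2) (by simp)
  have hu2i : Integrable (fun x => u x ^ 2) (volume : Measure (Ed d)) := by
    apply Continuous.integrable_of_hasCompactSupport (by fun_prop)
    exact hs.comp_left (g := fun z => z ^ 2) (by simp)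
  have hm : ∀ j ∈ gridIdx d n, MeasurableSet (cell d (L / n) j) := fun j _ => cell_meas _ _ _
  have hdj : (↑(gridIdx d n) : Set (Fin d → ℤ)).Pairwise
      (Function.onFun Disjoint (cell d (L / n))) := fun j _ k _ hjk => cell_disj d _ hl j k hjk
  calc ∫ x in Metric.ball (0 : Ed d) L, u x ^ 2
      ≤ ∫ x in ⋃ j ∈ gridIdx d n, cell d (L / n) j, u x ^ 2 := by
        apply setIntegral_mono_set hu2i.integrableOn (ae_of_all _ fun x => sq_nonneg _)
        exact (ball_sub_cells d L n hL hn).eventuallyLE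
    _ = ∑ j ∈ gridIdx d n, ∫ x in cell d (L / n) j, u x ^ 2 :=
        integral_biUnion_finset _ hm hdj (fun j _ => hu2i.integrableOn)
    _ ≤ ∑ j ∈ gridIdx d n, 2 ^ d * d * (L / n) ^ 2 *
          ∫ x in cell d (L / n) j, ‖fderiv ℝ u x‖ ^ 2 := by
        apply Finset.sum_le_sum
        intro j hj
        have := aux_poincare d _ (cell_convex d _ j) (cell_meas d _ j) (cell_finite d _ hl j)
          _ (cell_diam d _ hl j) u hu hs (h0 j hj)
        rw [mul_pow, Real.sq_sqrt (by positivity), ← mul_assoc] at this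
        exact this
    _ = 2 ^ d * d * (L / n) ^ 2 *
          ∫ x in ⋃ j ∈ gridIdx d n, cell d (L / n) j, ‖fderiv ℝ u x‖ ^ 2 := by
        rw [integral_biUnion_finset _ hm hdj (fun j _ => hGi.integrableOn), Finset.mul_sum]
    _ ≤ _ := by
        refine mul_le_mul_of_nonneg_left ?_ (by positivity)
        exact setIntegral_le_integral hGi (ae_of_all _ fun x => by positivity)

set_option maxHeartbeats 1000000 in
/-- Lower bound for the quadratic form by integration by parts. -/
lemma aux_form (d : ℕ) (ρ : ℝ) (hρ : ρ ∈ Set.Ioo (0 : ℝ) 1)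
    (W : Ed d → ℝ) (hW : SClass d 2 ρ W)
    (η φ : Ed d → ℝ) (hη : IsAdmissible d η 0 φ) :
    ∃ A : ℝ, 0 < A ∧ ∀ u : Ed d → ℝ, ContDiff ℝ 1 u → HasCompactSupport u →
      (1 / 2) * (∫ x, ‖fderiv ℝ u x‖ ^ 2) - A * ∫ x, (1 + ‖x‖) ^ (-(2 * ρ)) * u x ^ 2
        ≤ ∫ x, (‖gradient u x‖ ^ 2 + η x * W x * u x ^ 2) := by
  obtain ⟨hWs, C, hC, hWb⟩ := hW
  obtain ⟨M, hM⟩ := hη.bounded 1 (by norm_num)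
  have hM0 : 0 ≤ M := (norm_nonneg _).trans (hM 0)
  have hφ := hη.smooth
  let e : Fin d → Ed d := fun i => EuclideanSpace.single i 1
  have he : ∀ i, ‖e i‖ = 1 := fun i => by simp [e]
  refine ⟨d * (M * C + 2 * M ^ 2 * C ^ 2) + 1, by positivity, ?_⟩
  intro u hu hs
  have hnorm : ∀ x, ‖fderiv ℝ u x‖ ^ 2 = ∑ i, (fderiv ℝ u x (e i)) ^ 2 := by
    intro x
    have h1 : ‖gradient u x‖ = ‖fderiv ℝ u x‖ := by simp [gradient]
    rw [← h1, EuclideanSpace.norm_sq_eq]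
    apply Finset.sum_congr rfl
    intro i _
    have : (gradient u x) i = fderiv ℝ u x (e i) := by
      have h2 : fderiv ℝ u x (e i) = inner ℝ (gradient u x) (e i) := by
        simp [gradient]
      rw [h2]
      change _ = inner ℝ (gradient u x) (EuclideanSpace.single i 1)
      rw [EuclideanSpace.inner_single_right]
      simp
    rw [this, Real.norm_eq_abs, sq_abs]
  have hgn : ∀ x, ‖gradient u x‖ = ‖fderiv ℝ u x‖ := fun x => by simp [gradient]
  have hfu : Continuous (fderiv ℝ u) := hu.continuous_fderiv (by norm_num)
  have hfW : Continuous (fderiv ℝ W) := hWs.continuous_fderiv (by norm_num)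
  have hfφ : ContDiff ℝ 1 (fderiv ℝ φ) := hφ.fderiv_right (by norm_num)
  have hffφ : Continuous (fderiv ℝ (fderiv ℝ φ)) := hfφ.continuous_fderiv (by norm_num)
  have hfφc : Continuous (fderiv ℝ φ) := hfφ.continuous
  have huc := hu.continuous
  have hWc := hWs.continuous
  have hu2s : HasCompactSupport (fun x => u x ^ 2) :=
    hs.comp_left (g := fun z => z ^ 2) (by simp)
  have hgi : Integrable (fun x => ‖fderiv ℝ u x‖ ^ 2) (volume : Measure (Ed d)) := by
    apply Continuous.integrable_of_hasCompactSupport (by fun_prop)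
    exact (hs.fderiv (𝕜 := ℝ)).comp_left (g := fun z => ‖z‖ ^ 2) (by simp)
  have hqc : Continuous (fun x : Ed d => (1 + ‖x‖) ^ (-(2 * ρ))) := by
    apply Continuous.rpow_const (by fun_prop)
    intro x
    left
    positivity
  have hqi : Integrable (fun x => (1 + ‖x‖) ^ (-(2 * ρ)) * u x ^ 2) (volume : Measure (Ed d)) :=
    Continuous.integrable_of_hasCompactSupport (by fun_prop) hu2s.mul_left
  have hηe : ∀ x, η x = ∑ i, fderiv ℝ (fderiv ℝ φ) x (e i) (e i) := by
    intro x
    have := hη.poisson x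
    simp only [lap, iteratedFDeriv_two_apply, sub_zero] at this
    rw [← this]
    rfl
  have hηc : Continuous η := by
    rw [funext hηe]
    fun_prop
  have hVi : Integrable (fun x => η x * W x * u x ^ 2) (volume : Measure (Ed d)) :=
    Continuous.integrable_of_hasCompactSupport (by fun_prop) hu2s.mul_left
  let g : Ed d → ℝ := fun x => W x * u x ^ 2
  have hg1 : ContDiff ℝ 1 g := (hWs.of_le (by norm_num)).mul (hu.pow 2)
  have hgc := hg1.continuous
  have hgs : HasCompactSupport g := hu2s.mul_left
  have hfg : Continuous (fderiv ℝ g) := hg1.continuous_fderiv (by norm_num)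
  have hgs' : ∀ i, HasCompactSupport (fun x => fderiv ℝ g x (e i)) := fun i =>
    (hgs.fderiv (𝕜 := ℝ)).comp_left (g := fun z : Ed d →L[ℝ] ℝ => z (e i)) (by simp)
  have hgd : ∀ i x, fderiv ℝ g x (e i)
      = fderiv ℝ W x (e i) * u x ^ 2 + 2 * W x * u x * fderiv ℝ u x (e i) := by
    intro i x
    have hWd : DifferentiableAt ℝ W x := (hWs.differentiable (by norm_num)) x
    have hud : DifferentiableAt ℝ u x := (hu.differentiable (by norm_num)) x
    have := (hWd.hasFDerivAt.mul (hud.hasFDerivAt.pow 2)).fderiv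
    have h2 : fderiv ℝ g x = _ := this
    rw [h2]
    simp
    ring
  have hfφd : ∀ i x, fderiv ℝ (fun x => fderiv ℝ φ x (e i)) x (e i)
      = fderiv ℝ (fderiv ℝ φ) x (e i) (e i) := by
    intro i x
    rw [fderiv_clm_apply ((hfφ.differentiable (by norm_num)) x) (by fun_prop)]
    simp
  have hi2 : ∀ i, Integrable (fun x => fderiv ℝ φ x (e i) * fderiv ℝ g x (e i))
      (volume : Measure (Ed d)) := fun i =>
    Continuous.integrable_of_hasCompactSupport (by fun_prop) (hgs' i).mul_left
  have hi1 : ∀ i, Integrable (fun x => fderiv ℝ (fderiv ℝ φ) x (e i) (e i) * g x)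
      (volume : Measure (Ed d)) := fun i =>
    Continuous.integrable_of_hasCompactSupport (by fun_prop) hgs.mul_left
  have hibp : ∀ i, ∫ x, fderiv ℝ φ x (e i) * fderiv ℝ g x (e i)
      = - ∫ x, fderiv ℝ (fderiv ℝ φ) x (e i) (e i) * g x := by
    intro i
    have := integral_mul_fderiv_eq_neg_fderiv_mul_of_integrable (μ := (volume : Measure (Ed d)))
      (f := fun x => fderiv ℝ φ x (e i)) (g := g) (v := e i)
      (by simp only [hfφd]; exact hi1 i) (hi2 i)
      (Continuous.integrable_of_hasCompactSupport (by fun_prop) hgs.mul_left)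
      (fun x _ => ((hfφ.differentiable (by norm_num)) x).clm_apply (by fun_prop))
      (fun x _ => (hg1.differentiable (by norm_num)) x)
    simp only [hfφd] at this
    exact this
  have hpot : ∫ x, η x * W x * u x ^ 2
      = - ∫ x, ∑ i, fderiv ℝ φ x (e i) * fderiv ℝ g x (e i) := by
    rw [integral_finsetSum _ (fun i _ => hi2 i)]
    simp only [hibp]
    rw [Finset.sum_neg_distrib, neg_neg, ← integral_finsetSum _ (fun i _ => hi1 i)]
    apply integral_congr_ae
    refine ae_of_all _ fun x => ?_
    simp only [hηe, g, Finset.sum_mul]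
    exact Finset.sum_congr rfl fun i _ => by ring
  have hpt : ∀ x, ∑ i, fderiv ℝ φ x (e i) * fderiv ℝ g x (e i)
      ≤ 1 / 2 * ‖fderiv ℝ u x‖ ^ 2
        + (d * (M * C + 2 * M ^ 2 * C ^ 2) + 1) * ((1 + ‖x‖) ^ (-(2 * ρ)) * u x ^ 2) := by
    intro x
    have hx1 : 1 ≤ 1 + ‖x‖ := by linarith [norm_nonneg x]
    have hx0 : 0 < 1 + ‖x‖ := by linarith
    set q := (1 + ‖x‖) ^ (-(2 * ρ)) with hq
    have hq0 : 0 < q := by positivity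
    have hW0 : |W x| ≤ C * (1 + ‖x‖) ^ (-ρ) := by
      have := hWb 0 (by norm_num) x
      simpa using this
    have hWsq : W x ^ 2 ≤ C ^ 2 * q := by
      rw [← sq_abs]
      calc |W x| ^ 2 ≤ (C * (1 + ‖x‖) ^ (-ρ)) ^ 2 := by gcongr
        _ = C ^ 2 * q := by
          rw [mul_pow, hq, ← Real.rpow_natCast ((1 + ‖x‖) ^ (-ρ)), ← Real.rpow_mul hx0.le]
          congr 2
          push_cast
          ring
    have hW1 : ‖fderiv ℝ W x‖ ≤ C * q := by
      have := hWb 1 (by norm_num) x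
      rw [norm_iteratedFDeriv_one] at this
      refine this.trans ?_
      gcongr
      apply Real.rpow_le_rpow_of_exponent_le hx1
      push_cast
      linarith [hρ.2]
    have hM1 : ‖fderiv ℝ φ x‖ ≤ M := by
      have := hM x
      rwa [norm_iteratedFDeriv_one] at this
    have hterm : ∀ i, fderiv ℝ φ x (e i) * fderiv ℝ g x (e i)
        ≤ 1 / 2 * (fderiv ℝ u x (e i)) ^ 2 + (M * C + 2 * M ^ 2 * C ^ 2) * (q * u x ^ 2) := by
      intro i
      rw [hgd]
      set p := fderiv ℝ φ x (e i)
      set w := fderiv ℝ W x (e i)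
      set v := fderiv ℝ u x (e i)
      have hp : |p| ≤ M := by
        have := (fderiv ℝ φ x).le_opNorm (e i)
        rw [he, mul_one] at this
        exact this.trans hM1
      have hw : |w| ≤ C * q := by
        have := (fderiv ℝ W x).le_opNorm (e i)
        rw [he, mul_one] at this
        exact this.trans hW1
      have hpw : p * w ≤ M * (C * q) := by
        calc p * w ≤ |p * w| := le_abs_self _
          _ = |p| * |w| := abs_mul _ _
          _ ≤ _ := by gcongr
      have h1 : p * w * u x ^ 2 ≤ M * (C * q) * u x ^ 2 := by gcongr
      have hp2 : p ^ 2 ≤ M ^ 2 := by rw [← sq_abs]; gcongr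
      have h2 : p ^ 2 * W x ^ 2 * u x ^ 2 ≤ M ^ 2 * (C ^ 2 * q) * u x ^ 2 := by gcongr
      linarith [sq_nonneg (v - 2 * (p * W x * u x))]
    calc _ ≤ ∑ i, (1 / 2 * (fderiv ℝ u x (e i)) ^ 2
          + (M * C + 2 * M ^ 2 * C ^ 2) * (q * u x ^ 2)) := Finset.sum_le_sum fun i _ => hterm i
      _ = 1 / 2 * ‖fderiv ℝ u x‖ ^ 2 + d * (M * C + 2 * M ^ 2 * C ^ 2) * (q * u x ^ 2) := by
        rw [Finset.sum_add_distrib, ← Finset.mul_sum, hnorm]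
        simp
        ring
      _ ≤ _ := by
        have : 0 ≤ q * u x ^ 2 := by positivity
        nlinarith
  have hInteg := integral_mono (integrable_finsetSum _ (fun i _ => hi2 i))
    ((hgi.const_mul (1 / 2)).add (hqi.const_mul (d * (M * C + 2 * M ^ 2 * C ^ 2) + 1))) hpt
  have hsplit : ∫ x, (1 / 2 * ‖fderiv ℝ u x‖ ^ 2
        + (d * (M * C + 2 * M ^ 2 * C ^ 2) + 1) * ((1 + ‖x‖) ^ (-(2 * ρ)) * u x ^ 2))
      = 1 / 2 * (∫ x, ‖fderiv ℝ u x‖ ^ 2) + (d * (M * C + 2 * M ^ 2 * C ^ 2) + 1) *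
        ∫ x, (1 + ‖x‖) ^ (-(2 * ρ)) * u x ^ 2 := by
    rw [integral_add (hgi.const_mul _) (hqi.const_mul _), integral_const_mul, integral_const_mul]
  have hInteg' := hInteg.trans_eq hsplit
  simp only [hgn]
  rw [integral_add hgi hVi, hpot]
  linarith

/-- Pointwise domination of the effective potential by nested balls. -/
lemma aux_q (d : ℕ) (ρ : ℝ) (hρ : ρ ∈ Set.Ioo (0 : ℝ) 1) (β : ℝ) (hβ : β = 2 ^ (2 * ρ)) (K : ℕ)
    (x : Ed d) :
    (1 + ‖x‖) ^ (-(2 * ρ)) ≤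
      (∑ k ∈ Finset.range (K + 1), 4 * (β ^ k)⁻¹ *
        (Metric.ball (0 : Ed d) (2 ^ k)).indicator (fun _ => (1 : ℝ)) x) + (β ^ K)⁻¹ := by
  have hβ0 : 0 < β := by rw [hβ]; positivity
  have hβ4 : β ≤ 4 := by
    rw [hβ]
    calc (2 : ℝ) ^ (2 * ρ) ≤ 2 ^ (2 : ℝ) :=
          Real.rpow_le_rpow_of_exponent_le (by norm_num) (by linarith [hρ.2])
      _ = 4 := by norm_num
  have hq : ∀ m : ℕ, 2 ^ m ≤ ‖x‖ → (1 + ‖x‖) ^ (-(2 * ρ)) ≤ (β ^ m)⁻¹ := by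
    intro m hm
    have h1 : (β ^ m)⁻¹ = ((2 : ℝ) ^ m) ^ (-(2 * ρ)) := by
      rw [hβ, Real.rpow_neg (by positivity), ← Real.rpow_natCast, ← Real.rpow_natCast,
        ← Real.rpow_mul (by norm_num), ← Real.rpow_mul (by norm_num), mul_comm]
    rw [h1]
    apply Real.rpow_le_rpow_of_nonpos (by positivity) (by linarith) (by linarith [hρ.1])
  have hnn : ∀ k ∈ Finset.range (K + 1), 0 ≤ 4 * (β ^ k)⁻¹ *
        (Metric.ball (0 : Ed d) (2 ^ k)).indicator (fun _ => (1 : ℝ)) x := by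
    intro k _
    have : 0 ≤ (Metric.ball (0 : Ed d) (2 ^ k)).indicator (fun _ => (1 : ℝ)) x :=
      Set.indicator_nonneg (fun _ _ => zero_le_one) x
    positivity
  have hKp : 0 < (β ^ K)⁻¹ := by positivity
  by_cases hx : 2 ^ K ≤ ‖x‖
  · have := Finset.sum_nonneg hnn
    linarith [hq K hx]
  · push Not at hx
    have hex : ∃ k : ℕ, ‖x‖ < 2 ^ k := ⟨K, hx⟩
    classical
    let k := Nat.find hex
    have hk : ‖x‖ < 2 ^ k := Nat.find_spec hex
    have hkK : k ≤ K := Nat.find_min' hex hx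
    have hkm : k ∈ Finset.range (K + 1) := by simp; omega
    have h1 := Finset.single_le_sum hnn hkm
    have h2 : (Metric.ball (0 : Ed d) (2 ^ k)).indicator (fun _ => (1 : ℝ)) x = 1 := by
      apply Set.indicator_of_mem
      simpa using hk
    rw [h2, mul_one] at h1
    have h3 : (1 + ‖x‖) ^ (-(2 * ρ)) ≤ 4 * (β ^ k)⁻¹ := by
      rcases Nat.eq_zero_or_pos k with h0 | hp
      · rw [h0]
        have : (1 + ‖x‖) ^ (-(2 * ρ)) ≤ 1 :=
          Real.rpow_le_one_of_one_le_of_nonpos (by linarith [norm_nonneg x]) (by linarith [hρ.1])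
        simp only [pow_zero, inv_one]
        linarith
      · obtain ⟨m, hm⟩ : ∃ m, k = m + 1 := ⟨k - 1, by omega⟩
        have hmm : ¬ ‖x‖ < 2 ^ m := Nat.find_min hex (by omega : m < k)
        have := hq m (not_lt.1 hmm)
        refine this.trans ?_
        rw [hm, pow_succ, mul_inv]
        have h5 : 0 < (β ^ m)⁻¹ := by positivity
        have h6 : 1 ≤ 4 * β⁻¹ := by
          rw [← div_eq_mul_inv, le_div_iff₀ hβ0]; linarith
        nlinarith
    linarith

lemma aux_geom (r : ℝ) (hr : 1 < r) (K : ℕ) :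
    ∑ k ∈ Finset.range (K + 1), r ^ k ≤ r ^ K * (r / (r - 1)) := by
  rw [geom_sum_eq hr.ne', ← mul_div_assoc]
  have : 0 < r - 1 := by linarith
  gcongr
  rw [pow_succ]
  linarith

/-- Poincaré at all scales controls the effective potential. -/
lemma aux_scale (d : ℕ) (ρ : ℝ) (hρ : ρ ∈ Set.Ioo (0 : ℝ) 1) (β s : ℝ)
    (hβ : β = 2 ^ (2 * ρ)) (hs1 : 1 < s) (hsβ : s ^ 4 * β = 4) (A : ℝ) (hA : 0 < A) :
    ∃ c : ℝ, 1 ≤ c ∧ ∀ (K : ℕ) (n : ℕ → ℕ), (∀ k, n k = ⌈c * s ^ (K + k)⌉₊) →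
      ∀ u : Ed d → ℝ, ContDiff ℝ 1 u → HasCompactSupport u →
      (∀ k ∈ Finset.range (K + 1), ∀ j ∈ gridIdx d (n k),
        ∫ x in cell d (2 ^ k / n k) j, u x = 0) →
      A * ∫ x, (1 + ‖x‖) ^ (-(2 * ρ)) * u x ^ 2 ≤
        1 / 2 * (∫ x, ‖fderiv ℝ u x‖ ^ 2) + A * (β ^ K)⁻¹ * ∫ x, u x ^ 2 := by
  have hβ0 : 0 < β := by rw [hβ]; positivity
  have hs0 : 0 < s := by linarith
  set r := s ^ 2 with hr
  have hr1 : 1 < r := one_lt_pow₀ hs1 (by norm_num)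
  have hr1' : 0 < r - 1 := by linarith
  set P : ℝ := 2 ^ d * d with hP
  have hP0 : 0 ≤ P := by positivity
  set S := 8 * A * P * (r / (r - 1)) with hS
  have hS0 : 0 ≤ S := by positivity
  refine ⟨1 + S, by linarith, ?_⟩
  set c := 1 + S with hc
  have hc1 : 1 ≤ c := by linarith
  have hc0 : 0 < c := by linarith
  intro K n hn u hu hsu h0
  have huc := hu.continuous
  have hu2s : HasCompactSupport (fun x => u x ^ 2) :=
    hsu.comp_left (g := fun z => z ^ 2) (by simp)
  have hu2i : Integrable (fun x => u x ^ 2) (volume : Measure (Ed d)) :=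
    Continuous.integrable_of_hasCompactSupport (by fun_prop) hu2s
  have hqc : Continuous (fun x : Ed d => (1 + ‖x‖) ^ (-(2 * ρ))) := by
    apply Continuous.rpow_const (by fun_prop)
    intro x
    left
    positivity
  have hqi : Integrable (fun x => (1 + ‖x‖) ^ (-(2 * ρ)) * u x ^ 2) (volume : Measure (Ed d)) :=
    Continuous.integrable_of_hasCompactSupport (by fun_prop) hu2s.mul_left
  set D := ∫ x, ‖fderiv ℝ u x‖ ^ 2 with hD
  have hD0 : 0 ≤ D := integral_nonneg fun x => sq_nonneg _
  have hbi : ∀ k : ℕ, Integrable (fun x => 4 * (β ^ k)⁻¹ *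
      (Metric.ball (0 : Ed d) (2 ^ k)).indicator (fun x => u x ^ 2) x)
      (volume : Measure (Ed d)) := fun k =>
    (hu2i.indicator Metric.isOpen_ball.measurableSet).const_mul _
  have h1 : ∫ x, (1 + ‖x‖) ^ (-(2 * ρ)) * u x ^ 2 ≤
      (∑ k ∈ Finset.range (K + 1), 4 * (β ^ k)⁻¹ *
        ∫ x in Metric.ball (0 : Ed d) (2 ^ k), u x ^ 2) + (β ^ K)⁻¹ * ∫ x, u x ^ 2 := by
    calc ∫ x, (1 + ‖x‖) ^ (-(2 * ρ)) * u x ^ 2 ≤ ∫ x, ((∑ k ∈ Finset.range (K + 1), 4 * (β ^ k)⁻¹ *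
        (Metric.ball (0 : Ed d) (2 ^ k)).indicator (fun x => u x ^ 2) x)
          + (β ^ K)⁻¹ * u x ^ 2) := by
          apply integral_mono hqi
          · exact (integrable_finsetSum _ (fun k _ => hbi k)).add (hu2i.const_mul _)
          · intro x
            have := mul_le_mul_of_nonneg_right (aux_q d ρ hρ β hβ K x) (sq_nonneg (u x))
            refine this.trans (le_of_eq ?_)
            rw [add_mul, Finset.sum_mul]
            congr 1
            apply Finset.sum_congr rfl
            intro k _
            by_cases hx : x ∈ Metric.ball (0 : Ed d) (2 ^ k)
            · simp only [Set.indicator_of_mem hx]; ring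
            · simp only [Set.indicator_of_notMem hx]; ring
      _ = _ := by
          rw [integral_add (integrable_finsetSum _ (fun k _ => hbi k)) (hu2i.const_mul _),
            integral_finsetSum _ (fun k _ => hbi k), integral_const_mul]
          congr 1
          apply Finset.sum_congr rfl
          intro k _
          rw [integral_const_mul, integral_indicator Metric.isOpen_ball.measurableSet]
  have h2 : ∀ k ∈ Finset.range (K + 1), 4 * (β ^ k)⁻¹ *
        ∫ x in Metric.ball (0 : Ed d) (2 ^ k), u x ^ 2 ≤ 4 * P * D / (c ^ 2 * r ^ K) * r ^ k := by
    intro k hk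
    have hcs : 0 < c * s ^ (K + k) := by positivity
    have hnk : c * s ^ (K + k) ≤ n k := by rw [hn]; exact Nat.le_ceil _
    have hnk0 : (0 : ℝ) < n k := hcs.trans_le hnk
    have := aux_tile d (2 ^ k) (n k) (by positivity) (by exact_mod_cast hnk0) u hu hsu (h0 k hk)
    have h3 : ((2 : ℝ) ^ k / n k) ^ 2 ≤ (2 ^ k / (c * s ^ (K + k))) ^ 2 := by gcongr
    have h4 : ((2 : ℝ) ^ k / (c * s ^ (K + k))) ^ 2 = β ^ k * r ^ k / (c ^ 2 * r ^ K) := by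
      have h5 : ((2 : ℝ) ^ k) ^ 2 = (s ^ 4) ^ k * β ^ k := by
        rw [← mul_pow, hsβ, ← pow_mul, mul_comm, pow_mul]; norm_num
      rw [div_pow, h5, mul_pow, hr]
      rw [div_eq_div_iff (by positivity) (by positivity)]
      ring
    calc 4 * (β ^ k)⁻¹ * ∫ x in Metric.ball (0 : Ed d) (2 ^ k), u x ^ 2
        ≤ 4 * (β ^ k)⁻¹ * (P * (β ^ k * r ^ k / (c ^ 2 * r ^ K)) * D) := by
          refine mul_le_mul_of_nonneg_left (this.trans ?_) (by positivity)
          rw [← h4]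
          gcongr
      _ = _ := by
          field_simp
  have h3 := Finset.sum_le_sum h2
  rw [← Finset.mul_sum] at h3
  have h4 : 4 * P * D / (c ^ 2 * r ^ K) * ∑ k ∈ Finset.range (K + 1), r ^ k
      ≤ 4 * P * D / (c ^ 2 * r ^ K) * (r ^ K * (r / (r - 1))) := by
    gcongr
    exact aux_geom r hr1 K
  have hrK : r ^ K ≠ 0 := by positivity
  have h5 : A * (4 * P * D / (c ^ 2 * r ^ K) * (r ^ K * (r / (r - 1)))) = S / (2 * c ^ 2) * D := by
    rw [hS]
    field_simp
    ring
  have h6 : S / (2 * c ^ 2) ≤ 1 / 2 := by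
    rw [div_le_iff₀ (by positivity)]
    nlinarith
  have h7 : S / (2 * c ^ 2) * D ≤ 1 / 2 * D := by gcongr
  have h8 := mul_le_mul_of_nonneg_left h1 hA.le
  have h9 := mul_le_mul_of_nonneg_left (h3.trans h4) hA.le
  rw [h5] at h9
  rw [mul_add] at h8
  linarith

/-- Counting bound on the number of conditions. -/
lemma aux_card (d : ℕ) (hd : 1 ≤ d) (s : ℝ) (hs1 : 1 < s) (c : ℝ) (hc : 1 ≤ c) (K : ℕ)
    (n : ℕ → ℕ) (hn : ∀ k, n k = ⌈c * s ^ (K + k)⌉₊) :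
    ((∑ k ∈ Finset.range (K + 1), (2 * n k) ^ d : ℕ) : ℝ) ≤
      (4 * c) ^ d * (s ^ d / (s ^ d - 1)) * (s ^ (2 * d)) ^ K := by
  have hs0 : 0 < s := by linarith
  have ht : 1 < s ^ d := one_lt_pow₀ hs1 (by omega)
  push_cast
  calc ∑ k ∈ Finset.range (K + 1), (2 * (n k : ℝ)) ^ d
      ≤ ∑ k ∈ Finset.range (K + 1), (4 * c) ^ d * (s ^ d) ^ K * (s ^ d) ^ k := by
        apply Finset.sum_le_sum
        intro k _
        have h1 : 1 ≤ c * s ^ (K + k) := by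
          have : 1 ≤ s ^ (K + k) := one_le_pow₀ hs1.le
          nlinarith
        have h2 : (n k : ℝ) ≤ 2 * (c * s ^ (K + k)) := by
          rw [hn]
          have := Nat.ceil_lt_add_one (by linarith : 0 ≤ c * s ^ (K + k))
          linarith
        calc (2 * (n k : ℝ)) ^ d ≤ (2 * (2 * (c * s ^ (K + k)))) ^ d := by gcongr
          _ = _ := by
            rw [mul_assoc, ← pow_add, ← pow_mul, mul_comm d, pow_mul, ← mul_pow]
            congr 1
            ring
    _ = (4 * c) ^ d * (s ^ d) ^ K * ∑ k ∈ Finset.range (K + 1), (s ^ d) ^ k := by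
        rw [Finset.mul_sum]
    _ ≤ (4 * c) ^ d * (s ^ d) ^ K * ((s ^ d) ^ K * (s ^ d / (s ^ d - 1))) := by
        gcongr
        exact aux_geom _ ht K
    _ = _ := by ring

/-- Dimension bound. -/
lemma aux_dim (d : ℕ) (V : Ed d → ℝ) (E : ℝ) (K : ℕ) (n : ℕ → ℕ)
    (h : ∀ u : Ed d → ℝ, ContDiff ℝ 1 u → HasCompactSupport u →
      (∀ k ∈ Finset.range (K + 1), ∀ j ∈ gridIdx d (n k),
        ∫ x in cell d (2 ^ k / n k) j, u x = 0) →
      E * ∫ x, u x ^ 2 ≤ ∫ x, (‖gradient u x‖ ^ 2 + V x * u x ^ 2)) :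
    schN d V E ≤ ((∑ k ∈ Finset.range (K + 1), (2 * n k) ^ d : ℕ) : ℕ∞) := by
  apply iSup_le
  rintro ⟨F, hF1, hF2⟩
  simp only [Nat.cast_le]
  by_contra hlt
  push Not at hlt
  have hfin : Module.Finite ℝ F := Module.finite_of_finrank_pos (by omega)
  have hInteg : ∀ (u : F) (Q : Set (Ed d)), Integrable u.1 (volume.restrict Q) := fun u Q =>
    ((hF1 _ u.2).1.continuous.integrable_of_hasCompactSupport (hF1 _ u.2).2).restrict
  let ι := (Finset.range (K + 1)).sigma (fun k => gridIdx d (n k))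
  let T : F →ₗ[ℝ] (ι → ℝ) :=
    { toFun := fun u p => ∫ x in cell d (2 ^ p.1.1 / n p.1.1) p.1.2, u.1 x
      map_add' := by
        intro u v
        funext p
        exact integral_add (hInteg u _) (hInteg v _)
      map_smul' := by
        intro a u
        funext p
        exact integral_const_mul a _ }
  have hcard : Module.finrank ℝ (ι → ℝ) = ∑ k ∈ Finset.range (K + 1), (2 * n k) ^ d := by
    rw [Module.finrank_fintype_fun_eq_card, Fintype.card_coe, Finset.card_sigma]
    simp only [gridIdx_card]
  have hker : LinearMap.ker T ≠ ⊥ := LinearMap.ker_ne_bot_of_finrank_lt (by rw [hcard]; exact hlt)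
  obtain ⟨u, hu, hu0⟩ := (Submodule.ne_bot_iff _).1 hker
  have hform := hF2 u.1 u.2 (by simpa using hu0)
  have hge := h u.1 ((hF1 _ u.2).1.of_le (by norm_cast)) (hF1 _ u.2).2 (by
    intro k hk j hj
    have := congrFun (LinearMap.mem_ker.1 hu) ⟨⟨k, j⟩, Finset.mem_sigma.2 ⟨hk, hj⟩⟩
    exact this)
  exact absurd hform (not_lt.2 hge)

/-- Theorem 3.1 (ii), case `ρ ∈ (0,1)`: upper eigenvalue bound for vanishing mean value. -/
theorem eigenvalue_upper_bound_zero_mean_small_rho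
    (d : ℕ) (hd : 1 ≤ d) (ρ : ℝ) (hρ : ρ ∈ Set.Ioo (0 : ℝ) 1)
    (W : Ed d → ℝ) (hW : SClass d 2 ρ W)
    (η φ : Ed d → ℝ) (hη : IsAdmissible d η 0 φ) :
    ∃ C : ℝ, 0 < C ∧ ∃ E₀ : ℝ, E₀ < 0 ∧ ∀ E ∈ Set.Ioo E₀ (0 : ℝ),
      schN d (fun x => η x * W x) E ≠ ⊤ ∧
      ((schN d (fun x => η x * W x) E).toNat : ℝ) ≤
        C * |E| ^ (((d : ℝ) / 2) * (1 - 1 / ρ)) := by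

  obtain ⟨A, hA, hform⟩ := aux_form d ρ hρ W hW η φ hη
  have hρ0 := hρ.1
  have hρ1 := hρ.2
  set β : ℝ := 2 ^ (2 * ρ) with hβ
  set s : ℝ := 2 ^ ((1 - ρ) / 2) with hs
  have hβ1 : 1 < β := Real.one_lt_rpow (by norm_num) (by linarith)
  have hβ0 : 0 < β := by linarith
  have hs1 : 1 < s := Real.one_lt_rpow (by norm_num) (by linarith)
  have hs0 : 0 < s := by linarith
  have hsβ : s ^ 4 * β = 4 := by
    rw [hs, hβ, ← Real.rpow_natCast, ← Real.rpow_mul (by norm_num), ← Real.rpow_add (by norm_num)]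
    have : (1 - ρ) / 2 * ((4 : ℕ) : ℝ) + 2 * ρ = (2 : ℝ) := by push_cast; ring
    rw [this]
    norm_num
  obtain ⟨c, hc, hscale⟩ := aux_scale d ρ hρ β s hβ hs1 hsβ A hA
  have ht : 1 < s ^ d := one_lt_pow₀ hs1 (by omega)
  have ht' : 0 < s ^ d - 1 := by linarith
  set B : ℝ := (4 * c) ^ d * (s ^ d / (s ^ d - 1)) with hB
  have hB0 : 0 < B := by positivity
  set θ : ℝ := d * (1 - ρ) / (2 * ρ) with hθ
  have hθ0 : 0 ≤ θ := by
    have : 0 ≤ 1 - ρ := by linarith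
    positivity
  have hsθ : s ^ (2 * d) = β ^ θ := by
    rw [hs, hβ, ← Real.rpow_natCast, ← Real.rpow_mul (by norm_num), ← Real.rpow_mul (by norm_num)]
    congr 1
    rw [hθ]
    push_cast
    field_simp
  refine ⟨B * (β * A) ^ θ, by positivity, -A, by linarith, ?_⟩
  intro E hE
  obtain ⟨hE1, hE2⟩ := hE
  have he : 0 < -E := by linarith
  obtain ⟨m, hm1, hm2⟩ := exists_nat_pow_near (x := A / (-E)) (y := β)
    (by rw [one_le_div he]; linarith) hβ1
  let n : ℕ → ℕ := fun k => ⌈c * s ^ (m + 1 + k)⌉₊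
  have hdim := aux_dim d (fun x => η x * W x) E (m + 1) n (by
    intro u hu hsu h0
    have h1 := hform u hu hsu
    have h2 := hscale (m + 1) n (fun k => rfl) u hu hsu h0
    have h3 : A * (β ^ (m + 1))⁻¹ ≤ -E := by
      rw [← div_eq_mul_inv, div_le_iff₀ (by positivity)]
      rw [div_lt_iff₀ he] at hm2
      linarith
    have hI : 0 ≤ ∫ x, u x ^ 2 := integral_nonneg fun x => sq_nonneg _
    have h4 := mul_le_mul_of_nonneg_right h3 hI
    refine le_trans ?_ h1
    linarith)
  refine ⟨ne_top_of_le_ne_top (ENat.natCast_ne_top _) hdim, ?_⟩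
  have hnat := ENat.toNat_le_of_le_natCast hdim
  have hcard := aux_card d hd s hs1 c hc (m + 1) n (fun k => rfl)
  have hβm : β ^ (m + 1) ≤ β * A / (-E) := by
    rw [pow_succ, mul_comm, mul_div_assoc]
    gcongr
  have hexp : -θ = ((d : ℝ) / 2) * (1 - 1 / ρ) := by
    rw [hθ]
    field_simp
    ring
  calc ((schN d (fun x => η x * W x) E).toNat : ℝ)
      ≤ ((∑ k ∈ Finset.range (m + 1 + 1), (2 * n k) ^ d : ℕ) : ℝ) := by exact_mod_cast hnat
    _ ≤ B * (s ^ (2 * d)) ^ (m + 1) := hcard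
    _ = B * (β ^ (m + 1)) ^ θ := by
        rw [hsθ, ← Real.rpow_natCast, ← Real.rpow_natCast, ← Real.rpow_mul hβ0.le,
          ← Real.rpow_mul hβ0.le, mul_comm θ]
    _ ≤ B * (β * A / (-E)) ^ θ := by gcongr
    _ = B * (β * A) ^ θ * |E| ^ (((d : ℝ) / 2) * (1 - 1 / ρ)) := by
        rw [abs_of_neg hE2, div_eq_mul_inv, Real.mul_rpow (by positivity) (by positivity),
          Real.inv_rpow he.le, ← Real.rpow_neg he.le, hexp]
        ring

end
end

section
/- Let d ≥ 1, ρ ∈ (1,2], W ∈ S_{2,ρ}(ℝ^d), and let η = η₀ + η̃ be admissible with mean value η₀ = 0. Then sup_{E < 0} N(E; ηW) < ∞, i.e. the Schrödinger operator -Δ + ηW has at most finitely many negative eigenvalues. -/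
open MeasureTheory Filter Real Set Topology

noncomputable section

lemma integrable_grad_sq (d : ℕ) (u : Ed d → ℝ) (hu : ContDiff ℝ 1 u) (hs : HasCompactSupport u) :
    Integrable (fun x => ‖fderiv ℝ u x‖ ^ 2) := by
  have hc : Continuous (fderiv ℝ u) := hu.continuous_fderiv (by norm_num)
  have h0 : HasCompactSupport (fderiv ℝ u) := hs.fderiv ℝ
  have h1 : HasCompactSupport (fun x => ‖fderiv ℝ u x‖) := h0.norm
  have h2 : HasCompactSupport (fun x => ‖fderiv ℝ u x‖ ^ 2) :=
    h1.comp_left (g := fun y : ℝ => y ^ 2) (by simp)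
  have h3 : Continuous (fun x => ‖fderiv ℝ u x‖ ^ 2) := by fun_prop
  exact h3.integrable_of_hasCompactSupport h2

/-- The translation estimate. -/
lemma translation_estimate (d : ℕ) (u : Ed d → ℝ) (hu : ContDiff ℝ 1 u) (h : Ed d) :
    ∫⁻ x, ENNReal.ofReal ((u x - u (x + h)) ^ 2) ≤
      ENNReal.ofReal (‖h‖ ^ 2) * ∫⁻ x, ENNReal.ofReal (‖fderiv ℝ u x‖ ^ 2) := by
  have hc : Continuous (fderiv ℝ u) := hu.continuous_fderiv (by norm_num)
  have hd : Differentiable ℝ u := hu.differentiable (by norm_num)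
  have key : ∀ x, ENNReal.ofReal ((u x - u (x + h)) ^ 2) ≤
      ∫⁻ t in Icc (0:ℝ) 1, ENNReal.ofReal (‖h‖ ^ 2 * ‖fderiv ℝ u (x + t • h)‖ ^ 2) := by
    intro x
    have hct : Continuous (fun t : ℝ => fderiv ℝ u (x + t • h)) := by fun_prop
    have hF : Continuous (fun t : ℝ => fderiv ℝ u (x + t • h) h) := by fun_prop
    have h1 : ∫ t in (0:ℝ)..1, fderiv ℝ u (x + t • h) h = u (x + h) - u x := by
      have := intervalIntegral.integral_eq_sub_of_hasDerivAt (a := 0) (b := 1)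
        (f := fun t : ℝ => u (x + t • h)) (f' := fun t : ℝ => fderiv ℝ u (x + t • h) h)
        (fun t _ => by
          have h2 : HasDerivAt (fun t : ℝ => x + t • h) h t := by
            simpa using ((hasDerivAt_id t).smul_const h).const_add x
          exact (hd (x + t • h)).hasFDerivAt.comp_hasDerivAt t h2)
        (hF.intervalIntegrable 0 1)
      simpa using this
    have hprob : IsProbabilityMeasure (volume.restrict (Icc (0:ℝ) 1)) := ⟨by simp⟩
    have h3 : (∫ t in Icc (0:ℝ) 1, fderiv ℝ u (x + t • h) h) ^ 2 ≤
        ∫ t in Icc (0:ℝ) 1, (fderiv ℝ u (x + t • h) h) ^ 2 := by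
      have := ConvexOn.map_integral_le (μ := volume.restrict (Icc (0:ℝ) 1))
        (f := fun t : ℝ => fderiv ℝ u (x + t • h) h) (g := fun y : ℝ => y ^ 2) (s := univ)
        (even_two.convexOn_pow) (by fun_prop) isClosed_univ (by simp)
        (hF.continuousOn.integrableOn_Icc)
        ((hF.pow 2).continuousOn.integrableOn_Icc)
      exact this
    rw [intervalIntegral.integral_of_le zero_le_one, ← integral_Icc_eq_integral_Ioc] at h1
    have h4 : (u x - u (x + h)) ^ 2 ≤
        ∫ t in Icc (0:ℝ) 1, ‖h‖ ^ 2 * ‖fderiv ℝ u (x + t • h)‖ ^ 2 := by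
      calc (u x - u (x + h)) ^ 2 = (∫ t in Icc (0:ℝ) 1, fderiv ℝ u (x + t • h) h) ^ 2 := by
            rw [h1]; ring
        _ ≤ _ := h3
        _ ≤ _ := by
            apply integral_mono
            · exact (hF.pow 2).continuousOn.integrableOn_Icc
            · exact Continuous.integrableOn_Icc (by fun_prop)
            · intro t
              have := (fderiv ℝ u (x + t • h)).le_opNorm h
              have h5 : |fderiv ℝ u (x + t • h) h| ≤ ‖fderiv ℝ u (x + t • h)‖ * ‖h‖ := this
              simp only
              calc (fderiv ℝ u (x + t • h) h) ^ 2 = |fderiv ℝ u (x + t • h) h| ^ 2 := (sq_abs _).symm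
                _ ≤ (‖fderiv ℝ u (x + t • h)‖ * ‖h‖) ^ 2 := by gcongr
                _ = _ := by ring
    calc _ ≤ ENNReal.ofReal (∫ t in Icc (0:ℝ) 1, ‖h‖ ^ 2 * ‖fderiv ℝ u (x + t • h)‖ ^ 2) :=
          ENNReal.ofReal_le_ofReal h4
      _ = _ := by
          apply ofReal_integral_eq_lintegral_ofReal
          · exact Continuous.integrableOn_Icc (by fun_prop)
          · exact Eventually.of_forall fun t => by positivity
  calc _ ≤ ∫⁻ x, ∫⁻ t in Icc (0:ℝ) 1, ENNReal.ofReal (‖h‖ ^ 2 * ‖fderiv ℝ u (x + t • h)‖ ^ 2) :=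
        lintegral_mono key
    _ = ∫⁻ t in Icc (0:ℝ) 1, ∫⁻ x, ENNReal.ofReal (‖h‖ ^ 2 * ‖fderiv ℝ u (x + t • h)‖ ^ 2) := by
        apply lintegral_lintegral_swap
        apply Measurable.aemeasurable
        apply ENNReal.measurable_ofReal.comp
        apply Continuous.measurable
        fun_prop
    _ = ∫⁻ t in Icc (0:ℝ) 1, ENNReal.ofReal (‖h‖ ^ 2) * ∫⁻ x, ENNReal.ofReal (‖fderiv ℝ u x‖ ^ 2) := by
        congr 1
        ext t
        rw [lintegral_add_right_eq_self
          (fun x => ENNReal.ofReal (‖h‖ ^ 2 * ‖fderiv ℝ u x‖ ^ 2)) (t • h)]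
        simp_rw [ENNReal.ofReal_mul (sq_nonneg ‖h‖)]
        rw [lintegral_const_mul]
        apply ENNReal.measurable_ofReal.comp
        apply Continuous.measurable
        fun_prop
    _ = _ := by simp

/-- Local Poincare type estimate with finitely many vanishing averages. -/
lemma poincare_cover (d : ℕ) (u : Ed d → ℝ) (hu : ContDiff ℝ 1 u) (hs : HasCompactSupport u)
    (ε : ℝ) (hε : 0 < ε) (t : Set (Ed d)) (K : Set (Ed d)) (hK : MeasurableSet K)
    (hcov : K ⊆ ⋃ p ∈ t, Metric.ball p ε)
    (hav : ∀ p ∈ t, ∫ x in Metric.ball p ε, u x = 0) :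
    ∫ x in K, u x ^ 2 ≤ 2 ^ d * (2 * ε) ^ 2 * ∫ x, ‖fderiv ℝ u x‖ ^ 2 := by
  have hcu : Continuous u := hu.continuous
  have hc : Continuous (fderiv ℝ u) := hu.continuous_fderiv (by norm_num)
  have hiu : Integrable u := hcu.integrable_of_hasCompactSupport hs
  have hs2 : HasCompactSupport (fun x => u x ^ 2) :=
    hs.comp_left (g := fun y : ℝ => y ^ 2) (by simp)
  have hiu2 : Integrable (fun x => u x ^ 2) := (hcu.pow 2).integrable_of_hasCompactSupport hs2
  have hig : Integrable (fun x => ‖fderiv ℝ u x‖ ^ 2) :=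
    integrable_grad_sq d u hu hs
  set v : ENNReal := volume (Metric.ball (0 : Ed d) ε) with hv
  have hv0 : v ≠ 0 := (Metric.measure_ball_pos volume _ hε).ne'
  have hvt : v ≠ ⊤ := measure_ball_lt_top.ne
  have hball : ∀ p : Ed d, volume (Metric.ball p ε) = v := fun p =>
    Measure.addHaar_ball_center volume p ε
  have hv2 : volume (Metric.ball (0 : Ed d) (2 * ε)) = ENNReal.ofReal (2 ^ d) * v := by
    have := Measure.addHaar_ball_mul_of_pos (volume : Measure (Ed d)) (0 : Ed d) (r := 2) (by norm_num) ε
    simpa using this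
  have key : ∀ x ∈ K, ENNReal.ofReal (u x ^ 2) * v ≤
      ∫⁻ h in Metric.ball (0 : Ed d) (2 * ε), ENNReal.ofReal ((u x - u (x + h)) ^ 2) := by
    intro x hx
    obtain ⟨p, hp, hxp⟩ := by simpa using hcov hx
    have h1 : u x ^ 2 * v.toReal ≤ ∫ y in Metric.ball p ε, (u x - u y) ^ 2 := by
      have e : ∀ y, (u x - u y) ^ 2 = u x ^ 2 - 2 * u x * u y + u y ^ 2 := fun y => by ring
      simp_rw [e]
      have ic : IntegrableOn (fun _ : Ed d => u x ^ 2) (Metric.ball p ε) :=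
        integrableOn_const measure_ball_lt_top.ne
      have iu : IntegrableOn (fun y : Ed d => 2 * u x * u y) (Metric.ball p ε) :=
        hiu.integrableOn.const_mul _
      have is : IntegrableOn (fun y : Ed d => u x ^ 2 - 2 * u x * u y) (Metric.ball p ε) :=
        ic.sub iu
      rw [integral_add is hiu2.integrableOn,
        integral_sub ic iu, integral_const_mul, hav p hp,
        setIntegral_const, Measure.real, hball]
      have : 0 ≤ ∫ y in Metric.ball p ε, u y ^ 2 := integral_nonneg fun y => sq_nonneg _
      simp only [smul_eq_mul]
      nlinarith
    calc ENNReal.ofReal (u x ^ 2) * v = ENNReal.ofReal (u x ^ 2 * v.toReal) := by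
          rw [ENNReal.ofReal_mul (sq_nonneg _), ENNReal.ofReal_toReal hvt]
      _ ≤ ENNReal.ofReal (∫ y in Metric.ball p ε, (u x - u y) ^ 2) := ENNReal.ofReal_le_ofReal h1
      _ = ∫⁻ y in Metric.ball p ε, ENNReal.ofReal ((u x - u y) ^ 2) := by
          apply ofReal_integral_eq_lintegral_ofReal
          · have : Continuous (fun y => (u x - u y) ^ 2) := by fun_prop
            exact (this.continuousOn.integrableOn_compact
              (isCompact_closedBall p ε)).mono_set Metric.ball_subset_closedBall
          · exact Eventually.of_forall fun y => sq_nonneg _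
      _ = ∫⁻ y, (Metric.ball p ε).indicator (fun y => ENNReal.ofReal ((u x - u y) ^ 2)) y := by
          rw [lintegral_indicator measurableSet_ball]
      _ = ∫⁻ h, (Metric.ball p ε).indicator (fun y => ENNReal.ofReal ((u x - u y) ^ 2)) (x + h) := by
          rw [lintegral_add_left_eq_self]
      _ ≤ ∫⁻ h, (Metric.ball (0 : Ed d) (2 * ε)).indicator
            (fun h => ENNReal.ofReal ((u x - u (x + h)) ^ 2)) h := by
          apply lintegral_mono
          intro h
          simp only [indicator]
          split_ifs with ha hb hb
          · exact le_rfl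
          · exfalso
            apply hb
            rw [Metric.mem_ball] at ha
            rw [mem_ball_zero_iff]
            have h9 : dist (x + h) x ≤ dist (x + h) p + dist x p := dist_triangle_right _ _ _
            have : dist (x + h) x = ‖h‖ := by simp [dist_eq_norm]
            linarith
          · exact zero_le
          · exact le_rfl
      _ = _ := by rw [lintegral_indicator measurableSet_ball]
  have main : (∫⁻ x in K, ENNReal.ofReal (u x ^ 2)) * v ≤
      (ENNReal.ofReal (2 ^ d * (2 * ε) ^ 2) * ∫⁻ x, ENNReal.ofReal (‖fderiv ℝ u x‖ ^ 2)) * v := by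
    calc (∫⁻ x in K, ENNReal.ofReal (u x ^ 2)) * v
        = ∫⁻ x in K, ENNReal.ofReal (u x ^ 2) * v := by
          rw [lintegral_mul_const]
          exact ENNReal.measurable_ofReal.comp (hcu.pow 2).measurable
      _ ≤ ∫⁻ x in K, ∫⁻ h in Metric.ball (0 : Ed d) (2 * ε),
            ENNReal.ofReal ((u x - u (x + h)) ^ 2) := setLIntegral_mono' hK key
      _ ≤ ∫⁻ x, ∫⁻ h in Metric.ball (0 : Ed d) (2 * ε),
            ENNReal.ofReal ((u x - u (x + h)) ^ 2) := setLIntegral_le_lintegral _ _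
      _ = ∫⁻ h in Metric.ball (0 : Ed d) (2 * ε), ∫⁻ x,
            ENNReal.ofReal ((u x - u (x + h)) ^ 2) := by
          apply lintegral_lintegral_swap
          apply Measurable.aemeasurable
          apply ENNReal.measurable_ofReal.comp
          apply Continuous.measurable
          fun_prop
      _ ≤ ∫⁻ h in Metric.ball (0 : Ed d) (2 * ε), ENNReal.ofReal ((2 * ε) ^ 2) *
            ∫⁻ x, ENNReal.ofReal (‖fderiv ℝ u x‖ ^ 2) := by
          apply setLIntegral_mono' measurableSet_ball
          intro h hh
          refine (translation_estimate d u hu h).trans ?_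
          gcongr
          exact (mem_ball_zero_iff.1 hh).le
      _ = _ := by
          rw [lintegral_const, Measure.restrict_apply_univ, hv2, ENNReal.ofReal_mul (by positivity)]
          ring
  have main2 := (ENNReal.mul_le_mul_iff_left hv0 hvt).1 main
  rw [← ofReal_integral_eq_lintegral_ofReal hig (Eventually.of_forall fun x => by positivity),
    ← ofReal_integral_eq_lintegral_ofReal hiu2.integrableOn
      (Eventually.of_forall fun x => by positivity), ← ENNReal.ofReal_mul (by positivity)] at main2
  refine (ENNReal.ofReal_le_ofReal_iff ?_).1 main2
  have : 0 ≤ ∫ x, ‖fderiv ℝ u x‖ ^ 2 := integral_nonneg fun y => sq_nonneg _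
  positivity

/-- Coordinates of the gradient. -/
lemma grad_sq (d : ℕ) (u : Ed d → ℝ) (x : Ed d) :
    ‖gradient u x‖ ^ 2 = ∑ i, (fderiv ℝ u x (EuclideanSpace.single i 1)) ^ 2 := by
  rw [EuclideanSpace.real_norm_sq_eq]
  refine Finset.sum_congr rfl fun i _ => ?_
  rw [← inner_gradient_left, EuclideanSpace.inner_single_right]
  simp

lemma grad_norm (d : ℕ) (u : Ed d → ℝ) (x : Ed d) :
    ‖gradient u x‖ = ‖fderiv ℝ u x‖ := by
  simp [gradient]

lemma ibp (d : ℕ) (u : Ed d → ℝ) (hu : ContDiff ℝ 1 u) (hs : HasCompactSupport u)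
    (g : Ed d → ℝ) (hg : ContDiff ℝ 1 g) (e : Ed d) :
    ∫ x, (fderiv ℝ g x e * u x ^ 2 + 2 * (u x * g x * fderiv ℝ u x e)) = 0 := by
  have hcu : Continuous u := hu.continuous
  have hcg : Continuous g := hg.continuous
  have hc : Continuous (fderiv ℝ u) := hu.continuous_fderiv (by norm_num)
  have hc' : Continuous (fderiv ℝ g) := hg.continuous_fderiv (by norm_num)
  have hd : Differentiable ℝ u := hu.differentiable (by norm_num)
  have hd' : Differentiable ℝ g := hg.differentiable (by norm_num)
  have hs2 : HasCompactSupport (fun x => u x ^ 2) :=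
    hs.comp_left (g := fun y : ℝ => y ^ 2) (by simp)
  have hf : ∀ x, fderiv ℝ (fun x => u x ^ 2) x e = 2 * u x * fderiv ℝ u x e := by
    intro x
    rw [((hd x).hasFDerivAt.pow 2).fderiv]
    simp
  have i1 : Integrable (fun x => fderiv ℝ g x e * u x ^ 2) :=
    Continuous.integrable_of_hasCompactSupport (by fun_prop) hs2.mul_left
  have i2 : Integrable (fun x => u x ^ 2 * fderiv ℝ g x e) :=
    Continuous.integrable_of_hasCompactSupport (by fun_prop) hs2.mul_right
  have i3 : Integrable (fun x => 2 * (u x * g x * fderiv ℝ u x e)) := by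
    refine Continuous.integrable_of_hasCompactSupport (by fun_prop) ?_
    refine HasCompactSupport.mul_left (f := fun _ => (2:ℝ)) ?_
    exact hs.mul_right.mul_right
  have := integral_mul_fderiv_eq_neg_fderiv_mul_of_integrable (μ := volume)
    (f := fun x => u x ^ 2) (g := g) (v := e)
    (by simp_rw [hf]; refine i3.congr (Eventually.of_forall fun x => ?_); simp only; ring)
    i2
    (Continuous.integrable_of_hasCompactSupport (by fun_prop) hs2.mul_right)
    (fun x _ => (hd x).pow 2) (fun x _ => hd' x)
  rw [integral_add i1 i3]
  simp_rw [hf] at this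
  have e1 : ∫ x, fderiv ℝ g x e * u x ^ 2 = ∫ x, u x ^ 2 * fderiv ℝ g x e := by
    congr 1; ext x; ring
  have e2 : ∫ x, 2 * (u x * g x * fderiv ℝ u x e) = ∫ x, 2 * u x * fderiv ℝ u x e * g x := by
    congr 1; ext x; ring
  rw [e1, e2, this]; ring

lemma form_lower (d : ℕ) (V : Ed d → ℝ) (hV : Continuous V) (H : Fin d → Ed d → ℝ)
    (hH : ∀ i, ContDiff ℝ 1 (H i)) (M R : ℝ)
    (hb : ∀ x, -(M * (Metric.closedBall (0 : Ed d) R).indicator 1 x) ≤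
      V x + ∑ i, fderiv ℝ (H i) x (EuclideanSpace.single i 1) - 2 * ∑ i, H i x ^ 2)
    (u : Ed d → ℝ) (hu : ContDiff ℝ 1 u) (hs : HasCompactSupport u) :
    (1 / 2) * (∫ x, ‖fderiv ℝ u x‖ ^ 2) - M * ∫ x in Metric.closedBall (0 : Ed d) R, u x ^ 2 ≤
      ∫ x, (‖gradient u x‖ ^ 2 + V x * u x ^ 2) := by
  have hcu : Continuous u := hu.continuous
  have hc : Continuous (fderiv ℝ u) := hu.continuous_fderiv (by norm_num)
  have hcH : ∀ i, Continuous (H i) := fun i => (hH i).continuous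
  have hcH' : ∀ i, Continuous (fderiv ℝ (H i)) := fun i => (hH i).continuous_fderiv (by norm_num)
  have hs2 : HasCompactSupport (fun x => u x ^ 2) :=
    hs.comp_left (g := fun y : ℝ => y ^ 2) (by simp)
  have hiu2 : Integrable (fun x => u x ^ 2) := (hcu.pow 2).integrable_of_hasCompactSupport hs2
  have hig : Integrable (fun x => ‖fderiv ℝ u x‖ ^ 2) :=
    integrable_grad_sq d u hu hs
  have hiV : Integrable (fun x => V x * u x ^ 2) :=
    Continuous.integrable_of_hasCompactSupport (by fun_prop) hs2.mul_left
  set D : Fin d → Ed d → ℝ := fun i x =>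
    fderiv ℝ (H i) x (EuclideanSpace.single i 1) * u x ^ 2 +
      2 * (u x * H i x * fderiv ℝ u x (EuclideanSpace.single i 1)) with hD
  have hDi : ∀ i, Integrable (D i) := by
    intro i
    refine Continuous.integrable_of_hasCompactSupport ?_ ?_
    · have := hcH i
      have := hcH' i
      simp only [hD]
      fun_prop
    · refine HasCompactSupport.add hs2.mul_left ?_
      refine HasCompactSupport.mul_left (f := fun _ => (2:ℝ)) ?_
      exact hs.mul_right.mul_right
  have hDz : ∫ x, ∑ i, D i x = 0 := by
    rw [integral_finsetSum _ fun i _ => hDi i]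
    exact Finset.sum_eq_zero fun i _ => ibp d u hu hs (H i) (hH i) _
  have hDs : Integrable (fun x => ∑ i, D i x) := integrable_finsetSum _ fun i _ => hDi i
  have hind : Integrable (fun x => (Metric.closedBall (0 : Ed d) R).indicator
      (fun x => u x ^ 2) x) := hiu2.indicator measurableSet_closedBall
  have e1 : ∫ x in Metric.closedBall (0 : Ed d) R, u x ^ 2 =
      ∫ x, (Metric.closedBall (0 : Ed d) R).indicator (fun x => u x ^ 2) x := by
    rw [integral_indicator measurableSet_closedBall]
  simp_rw [grad_norm]
  calc _ = ∫ x, ((1 / 2) * ‖fderiv ℝ u x‖ ^ 2 - M * (Metric.closedBall (0 : Ed d) R).indicator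
        (fun x => u x ^ 2) x) := by
        rw [integral_sub (hig.const_mul _) (hind.const_mul _), integral_const_mul,
          integral_const_mul, e1]
    _ ≤ ∫ x, ((‖fderiv ℝ u x‖ ^ 2 + V x * u x ^ 2) + ∑ i, D i x) := by
        apply integral_mono ((hig.const_mul _).sub (hind.const_mul _)) ((hig.add hiV).add hDs)
        intro x
        have h1 := mul_le_mul_of_nonneg_right (hb x) (sq_nonneg (u x))
        have h2 : (Metric.closedBall (0 : Ed d) R).indicator (fun x => u x ^ 2) x =
            (Metric.closedBall (0 : Ed d) R).indicator (1 : Ed d → ℝ) x * u x ^ 2 := by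
          by_cases hx : x ∈ Metric.closedBall (0 : Ed d) R <;> simp [indicator, hx]
        have h3 : ‖fderiv ℝ u x‖ ^ 2 = ∑ i, (fderiv ℝ u x (EuclideanSpace.single i 1)) ^ 2 := by
          rw [← grad_norm, grad_sq]
        have h4 : 0 ≤ ∑ i, (1 / 2 : ℝ) * (fderiv ℝ u x (EuclideanSpace.single i 1) +
            2 * (u x * H i x)) ^ 2 := Finset.sum_nonneg fun i _ => by positivity
        have h5 : ∑ i, (1 / 2 : ℝ) * (fderiv ℝ u x (EuclideanSpace.single i 1) +
            2 * (u x * H i x)) ^ 2 + (∑ i, fderiv ℝ (H i) x (EuclideanSpace.single i 1)) * u x ^ 2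
            = (1 / 2) * ∑ i, (fderiv ℝ u x (EuclideanSpace.single i 1)) ^ 2
              + ∑ i, D i x + 2 * (∑ i, H i x ^ 2) * u x ^ 2 := by
          simp only [hD, Finset.mul_sum, Finset.sum_mul, ← Finset.sum_add_distrib]
          refine Finset.sum_congr rfl fun i _ => ?_
          ring
        simp only [Pi.add_apply, Pi.sub_apply]
        rw [h2]
        rw [← h3] at h5
        nlinarith
    _ = _ := by
        have := integral_add (hig.add hiV) hDs
        simp only [Pi.add_apply] at this
        rw [this, hDz, add_zero]

lemma count_finite (d : ℕ) (V : Ed d → ℝ) (hV : Continuous V) (H : Fin d → Ed d → ℝ)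
    (hH : ∀ i, ContDiff ℝ 1 (H i)) (M R : ℝ) (hM : 0 ≤ M)
    (hb : ∀ x, -(M * (Metric.closedBall (0 : Ed d) R).indicator 1 x) ≤
      V x + ∑ i, fderiv ℝ (H i) x (EuclideanSpace.single i 1) - 2 * ∑ i, H i x ^ 2) :
    (⨆ E ∈ Set.Iio (0 : ℝ), schN d V E) < ⊤ := by
  obtain ⟨ε, hε, hεM⟩ : ∃ ε : ℝ, 0 < ε ∧ M * (2 ^ d * (2 * ε) ^ 2) ≤ 1 / 2 := by
    have ht : Tendsto (fun ε : ℝ => M * (2 ^ d * (2 * ε) ^ 2)) (𝓝[>] 0) (𝓝 0) := by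
      have : Continuous (fun ε : ℝ => M * (2 ^ d * (2 * ε) ^ 2)) := by fun_prop
      have h := this.tendsto 0
      simp only [mul_zero, ne_eq, OfNat.ofNat_ne_zero, not_false_eq_true, zero_pow] at h
      exact h.mono_left nhdsWithin_le_nhds
    have h1 := ht.eventually (eventually_le_nhds (show (0:ℝ) < 1 / 2 by norm_num))
    obtain ⟨ε, h2, h3⟩ := (h1.and self_mem_nhdsWithin).exists
    exact ⟨ε, h3, h2⟩
  obtain ⟨t, -, ht, hcov⟩ := (isCompact_closedBall (0 : Ed d) R).finite_cover_balls hε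
  have := ht.fintype
  refine lt_of_le_of_lt (iSup₂_le fun E hE => ?_) (ENat.natCast_lt_top (Fintype.card t))
  refine iSup_le ?_
  rintro ⟨F, hF1, hF2⟩
  simp only
  have hint : ∀ u ∈ F, Integrable u := fun u hu =>
    (hF1 u hu).1.continuous.integrable_of_hasCompactSupport (hF1 u hu).2
  let L : F →ₗ[ℝ] (t → ℝ) :=
    { toFun := fun u p => ∫ x in Metric.ball p.1 ε, u.1 x
      map_add' := fun u w => by
        ext p
        exact integral_add (hint u.1 u.2).integrableOn (hint w.1 w.2).integrableOn
      map_smul' := fun c u => by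
        ext p
        exact integral_const_mul c _ }
  have hL : Function.Injective L := by
    rw [← LinearMap.ker_eq_bot, LinearMap.ker_eq_bot']
    rintro ⟨u, hu⟩ h0
    by_contra hne
    have hne' : u ≠ 0 := fun h => hne (by ext1; exact h)
    have hq := hF2 u hu hne'
    have hu1 : ContDiff ℝ 1 u := (hF1 u hu).1.of_le (by exact_mod_cast le_top)
    have hs := (hF1 u hu).2
    have h1 := form_lower d V hV H hH M R hb u hu1 hs
    have h2 := poincare_cover d u hu1 hs ε hε t _ measurableSet_closedBall hcov
      (fun p hp => congrFun h0 ⟨p, hp⟩)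
    have h3 : 0 ≤ ∫ x, u x ^ 2 := integral_nonneg fun y => sq_nonneg _
    have h4 : 0 ≤ ∫ x, ‖fderiv ℝ u x‖ ^ 2 := integral_nonneg fun y => sq_nonneg _
    have h5 := mul_le_mul_of_nonneg_left h2 hM
    have h6 := mul_le_mul_of_nonneg_right hεM h4
    have h7 : E * ∫ x, u x ^ 2 ≤ 0 := mul_nonpos_of_nonpos_of_nonneg (le_of_lt hE) h3
    nlinarith
  have := LinearMap.finrank_le_finrank_of_injective hL
  rw [Module.finrank_fintype_fun_eq_card] at this
  exact_mod_cast this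

lemma bracket_pow (r a : ℝ) (hr : 0 ≤ r) (ha : 0 ≤ a) :
    (1 + r) ^ (-a) ≤ (1 + r ^ 2) ^ (-(a / 2)) := by
  have h : (1 + r) ^ (-a) = ((1 + r) ^ 2) ^ (-(a / 2)) := by
    rw [← Real.rpow_natCast, ← Real.rpow_mul (by positivity)]
    congr 1; push_cast; ring
  rw [h]
  apply Real.rpow_le_rpow_of_nonpos (by positivity)
  · nlinarith
  · linarith

/-- The model vector field. -/
def mfield (d : ℕ) (c s : ℝ) (i : Fin d) (x : Ed d) : ℝ :=
  c * (x i * (1 + ‖x‖ ^ 2) ^ (-1 - s / 2))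

lemma mfield_contDiff (d : ℕ) (c s : ℝ) (i : Fin d) : ContDiff ℝ 1 (mfield d c s i) := by
  unfold mfield
  refine contDiff_const.mul (ContDiff.mul ?_ ?_)
  · exact (EuclideanSpace.proj (𝕜 := ℝ) i).contDiff
  · refine ContDiff.rpow_const_of_ne (contDiff_const.add (contDiff_norm_sq ℝ)) fun x => ?_
    positivity

lemma mfield_div (d : ℕ) (c s : ℝ) (x : Ed d) :
    ∑ i, fderiv ℝ (mfield d c s i) x (EuclideanSpace.single i 1) =
      c * (1 + ‖x‖ ^ 2) ^ (-1 - s / 2) * ((d - 2 - s) + (2 + s) * (1 + ‖x‖ ^ 2)⁻¹) := by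
  have hpos : (0:ℝ) < 1 + ‖x‖ ^ 2 := by positivity
  have h : ∀ i, fderiv ℝ (mfield d c s i) x (EuclideanSpace.single i 1) =
      c * ((1 + ‖x‖ ^ 2) ^ (-1 - s / 2) - (2 + s) * (1 + ‖x‖ ^ 2) ^ (-1 - s / 2 - 1) * x i ^ 2) := by
    intro i
    have h1 : HasFDerivAt (fun x : Ed d => x i) (EuclideanSpace.proj (𝕜 := ℝ) i) x :=
      (EuclideanSpace.proj (𝕜 := ℝ) i).hasFDerivAt
    have h2 : HasFDerivAt (fun x : Ed d => 1 + ‖x‖ ^ 2) (2 • innerSL ℝ x) x :=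
      (hasStrictFDerivAt_norm_sq x).hasFDerivAt.const_add 1
    have h3 := h2.rpow_const (p := -1 - s / 2) (Or.inl hpos.ne')
    have h4 := (h1.mul h3).const_mul c
    have h5 : HasFDerivAt (mfield d c s i) _ x := h4
    rw [h5.fderiv]
    simp [EuclideanSpace.inner_single_right]
    ring
  simp_rw [h]
  rw [← Finset.mul_sum, Finset.sum_sub_distrib, ← Finset.mul_sum,
    ← EuclideanSpace.real_norm_sq_eq, Real.rpow_sub_one hpos.ne' (-1 - s / 2)]
  simp only [Finset.sum_const, Finset.card_univ, Fintype.card_fin, nsmul_eq_mul]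
  field_simp
  ring

lemma mfield_sq (d : ℕ) (c s : ℝ) (x : Ed d) :
    ∑ i, mfield d c s i x ^ 2 ≤ c ^ 2 * (1 + ‖x‖ ^ 2) ^ (-1 - s) := by
  have hpos : (0:ℝ) < 1 + ‖x‖ ^ 2 := by positivity
  have h : ∀ i, mfield d c s i x ^ 2 = c ^ 2 * ((1 + ‖x‖ ^ 2) ^ (-2 - s) * x i ^ 2) := by
    intro i
    have : (1 + ‖x‖ ^ 2) ^ (-2 - s) = ((1 + ‖x‖ ^ 2) ^ (-1 - s / 2)) ^ 2 := by
      rw [← Real.rpow_natCast (_ ^ (-1 - s / 2)), ← Real.rpow_mul hpos.le]; congr 1; push_cast; ring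
    rw [this, mfield]; ring
  simp_rw [h]
  rw [← Finset.mul_sum, ← Finset.mul_sum, ← EuclideanSpace.real_norm_sq_eq]
  have e : (1 + ‖x‖ ^ 2) ^ (-1 - s) = (1 + ‖x‖ ^ 2) ^ (-2 - s) * (1 + ‖x‖ ^ 2) := by
    rw [← Real.rpow_add_one hpos.ne']; congr 1; ring
  rw [e]
  have := Real.rpow_pos_of_pos hpos (-2 - s)
  gcongr
  linarith

lemma bracket_lower (κ a b g e₁ e₂ e₃ s : ℝ) (hκ : 0 < κ) (ha : 0 ≤ a) (hb : 0 ≤ b) (hg : 0 ≤ g)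
    (he : 0 ≤ e₁) (h1 : 0 < s) (h2 : 0 < e₂) (h3 : 0 < e₃) :
    ∃ M R : ℝ, 0 ≤ M ∧ ∀ r : ℝ, 0 ≤ r → -(M * if r ≤ R then 1 else 0) ≤
      (1 + r ^ 2) ^ (-1 - s / 2) * (κ - a * (1 + r ^ 2)⁻¹ - b * (1 + r ^ 2) ^ (-(s / 2))
        - g * (1 + r ^ 2) ^ (-e₂) - e₁ * (1 + r ^ 2) ^ (-e₃)) := by
  have ht : Tendsto (fun t : ℝ => κ - a * t⁻¹ - b * t ^ (-(s / 2))
        - g * t ^ (-e₂) - e₁ * t ^ (-e₃)) atTop (𝓝 (κ - a * 0 - b * 0 - g * 0 - e₁ * 0)) :=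
    (((tendsto_const_nhds.sub (tendsto_inv_atTop_zero.const_mul a)).sub
      ((tendsto_rpow_neg_atTop (by positivity)).const_mul b)).sub
      ((tendsto_rpow_neg_atTop h2).const_mul g)).sub ((tendsto_rpow_neg_atTop h3).const_mul e₁)
  simp only [mul_zero, sub_zero] at ht
  obtain ⟨T, hT⟩ := eventually_atTop.1 (ht.eventually (eventually_ge_nhds hκ))
  refine ⟨a + b + g + e₁, max T 0, by positivity, fun r hr => ?_⟩
  have hp : (1:ℝ) ≤ 1 + r ^ 2 := by nlinarith
  have hq := Real.rpow_pos_of_pos (show (0:ℝ) < 1 + r ^ 2 by positivity) (-1 - s / 2)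
  split_ifs with h
  · have i1 : (1 + r ^ 2)⁻¹ ≤ 1 := inv_le_one_of_one_le₀ hp
    have i2 : (1 + r ^ 2) ^ (-(s / 2)) ≤ 1 := Real.rpow_le_one_of_one_le_of_nonpos hp (by linarith)
    have i3 : (1 + r ^ 2) ^ (-e₂) ≤ 1 := Real.rpow_le_one_of_one_le_of_nonpos hp (by linarith)
    have i4 : (1 + r ^ 2) ^ (-e₃) ≤ 1 := Real.rpow_le_one_of_one_le_of_nonpos hp (by linarith)
    have i5 : (1 + r ^ 2) ^ (-1 - s / 2) ≤ 1 :=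
      Real.rpow_le_one_of_one_le_of_nonpos hp (by linarith)
    have j : -(a + b + g + e₁) ≤ κ - a * (1 + r ^ 2)⁻¹ - b * (1 + r ^ 2) ^ (-(s / 2))
        - g * (1 + r ^ 2) ^ (-e₂) - e₁ * (1 + r ^ 2) ^ (-e₃) := by
      have := mul_le_mul_of_nonneg_left i1 ha
      have := mul_le_mul_of_nonneg_left i2 hb
      have := mul_le_mul_of_nonneg_left i3 hg
      have := mul_le_mul_of_nonneg_left i4 he
      linarith
    have k := mul_le_mul_of_nonneg_left j hq.le
    have l : (1 + r ^ 2) ^ (-1 - s / 2) * (a + b + g + e₁) ≤ 1 * (a + b + g + e₁) := by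
      gcongr
    linarith
  · rw [mul_zero, neg_zero]
    have hr2 : T ≤ 1 + r ^ 2 := by
      have := le_max_left T 0
      nlinarith [sq_nonneg (r - 1)]
    exact mul_nonneg hq.le (hT _ hr2)

lemma lap_eq (d : ℕ) (φ : Ed d → ℝ) (hφ : ContDiff ℝ 2 φ) (x : Ed d) :
    lap d φ x = ∑ i : Fin d, fderiv ℝ (fun y => fderiv ℝ φ y (EuclideanSpace.single i 1)) x
      (EuclideanSpace.single i 1) := by
  unfold lap
  refine Finset.sum_congr rfl fun i _ => ?_
  have hd : Differentiable ℝ (fderiv ℝ φ) :=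
    (hφ.fderiv_right (m := 1) (by norm_num)).differentiable (by norm_num)
  rw [iteratedFDeriv_two_apply, fderiv_clm_apply (hd x) (differentiableAt_const _)]
  simp

lemma lap_cont (d : ℕ) (φ : Ed d → ℝ) (hφ : ContDiff ℝ 2 φ) : Continuous (lap d φ) := by
  have h1 : Continuous (fderiv ℝ (fderiv ℝ φ)) :=
    (hφ.fderiv_right (m := 1) (by norm_num)).continuous_fderiv (by norm_num)
  have : lap d φ = fun x => ∑ i : Fin d, fderiv ℝ (fderiv ℝ φ) x (EuclideanSpace.single i 1)
      (EuclideanSpace.single i 1) := by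
    ext x
    unfold lap
    refine Finset.sum_congr rfl fun i _ => ?_
    rw [iteratedFDeriv_two_apply]
    simp
  rw [this]
  fun_prop

lemma abs_fderiv_single (d : ℕ) (g : Ed d → ℝ) (x : Ed d) (i : Fin d) :
    |fderiv ℝ g x (EuclideanSpace.single i 1)| ≤ ‖fderiv ℝ g x‖ := by
  have h := (fderiv ℝ g x).le_opNorm (EuclideanSpace.single i (1:ℝ))
  simpa using h

/-- The pointwise lower bound for the effective potential. -/
lemma pointwise_bound (d : ℕ) (ρ : ℝ) (hρ : ρ ∈ Set.Ioc (1 : ℝ) 2)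
    (W : Ed d → ℝ) (hW : SClass d 2 ρ W)
    (η φ : Ed d → ℝ) (hη : IsAdmissible d η 0 φ) (c s : ℝ) (hs : s = (ρ - 1) / 2)
    (hc : c = d - 2 - s) :
    ∃ M R : ℝ, 0 ≤ M ∧ ∀ x, -(M * (Metric.closedBall (0 : Ed d) R).indicator 1 x) ≤
      η x * W x + ∑ i, fderiv ℝ (fun y => mfield d c s i y -
        W y * fderiv ℝ φ y (EuclideanSpace.single i 1)) x (EuclideanSpace.single i 1)
      - 2 * ∑ i, (mfield d c s i x - W x * fderiv ℝ φ x (EuclideanSpace.single i 1)) ^ 2 := by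
  obtain ⟨hWs, C, hC, hWb⟩ := hW
  obtain ⟨hρ1, hρ2⟩ := hρ
  obtain ⟨M₁, hM₁⟩ := hη.bounded 1 (by norm_num)
  have hM0 : 0 ≤ M₁ := (norm_nonneg _).trans (hM₁ 0)
  have hs0 : 0 < s := by rw [hs]; linarith
  have hc0 : c ≠ 0 := by
    intro h
    have h1 : (d : ℝ) = 2 + s := by linarith
    have h2 : (2:ℝ) < d := by linarith
    have h3 : (d:ℝ) < 3 := by rw [h1, hs]; linarith
    have h4 : 2 < d := by exact_mod_cast h2
    have h5 : d < 3 := by exact_mod_cast h3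
    omega
  obtain ⟨M, R, hM, hMR⟩ := bracket_lower (c ^ 2) (|c| * (2 + s)) (4 * c ^ 2)
    (4 * (d * (C * M₁) ^ 2)) (d * (C * M₁)) (ρ - 1 - s / 2) ((ρ - 1 - s) / 2) s
    (by positivity) (by positivity) (by positivity) (by positivity) (by positivity) hs0
    (by rw [hs]; linarith) (by rw [hs]; linarith)
  refine ⟨M, R, hM, fun x => ?_⟩
  have hx := hMR ‖x‖ (norm_nonneg x)
  have hpos : (0:ℝ) < 1 + ‖x‖ ^ 2 := by positivity
  have hind : (Metric.closedBall (0 : Ed d) R).indicator (1 : Ed d → ℝ) x =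
      if ‖x‖ ≤ R then 1 else 0 := by simp [indicator]
  rw [hind]
  refine hx.trans ?_
  set t : ℝ := 1 + ‖x‖ ^ 2 with ht
  -- derivative bounds
  have dφ : ∀ i, |fderiv ℝ φ x (EuclideanSpace.single i 1)| ≤ M₁ := fun i =>
    (abs_fderiv_single d φ x i).trans (by rw [← norm_iteratedFDeriv_one]; exact hM₁ x)
  have bW : |W x| ≤ C * t ^ (-(ρ / 2)) := by
    have h := hWb 0 (by norm_num) x
    rw [norm_iteratedFDeriv_zero] at h
    simp only [Nat.cast_zero, sub_zero] at h
    exact h.trans (mul_le_mul_of_nonneg_left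
      (bracket_pow ‖x‖ ρ (norm_nonneg _) (by linarith)) hC.le)
  have dW : ∀ i, |fderiv ℝ W x (EuclideanSpace.single i 1)| ≤ C * t ^ (-((ρ + 1) / 2)) := fun i => by
    have h := hWb 1 (by norm_num) x
    rw [norm_iteratedFDeriv_one] at h
    have e : -ρ - ((1:ℕ) : ℝ) = -(ρ + 1) := by push_cast; ring
    rw [e] at h
    exact (abs_fderiv_single d W x i).trans (h.trans (mul_le_mul_of_nonneg_left
      (bracket_pow ‖x‖ (ρ + 1) (norm_nonneg _) (by linarith)) hC.le))
  -- the derivative of the field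
  have hWd : DifferentiableAt ℝ W x := (hWs.differentiable (by norm_num)) x
  have hpd : ∀ i : Fin d, DifferentiableAt ℝ
      (fun y => fderiv ℝ φ y (EuclideanSpace.single i (1:ℝ))) x := fun i => by
    have hd : Differentiable ℝ (fderiv ℝ φ) :=
      (hη.smooth.fderiv_right (m := 1) (by norm_num)).differentiable (by norm_num)
    exact (hd x).clm_apply (differentiableAt_const _)
  have hfd : ∀ i : Fin d, fderiv ℝ (fun y => mfield d c s i y -
        W y * fderiv ℝ φ y (EuclideanSpace.single i 1)) x (EuclideanSpace.single i 1) =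
      fderiv ℝ (mfield d c s i) x (EuclideanSpace.single i 1) -
      (W x * fderiv ℝ (fun y => fderiv ℝ φ y (EuclideanSpace.single i 1)) x
        (EuclideanSpace.single i 1) +
        fderiv ℝ W x (EuclideanSpace.single i 1) * fderiv ℝ φ x (EuclideanSpace.single i 1)) := by
    intro i
    have h1 : HasFDerivAt (mfield d c s i) _ x :=
      ((mfield_contDiff d c s i).differentiable (by norm_num) x).hasFDerivAt
    have h2 := hWd.hasFDerivAt.mul (hpd i).hasFDerivAt
    have h3 : HasFDerivAt (fun y => mfield d c s i y -
        W y * fderiv ℝ φ y (EuclideanSpace.single i 1)) _ x := h1.sub h2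
    rw [h3.fderiv]
    simp
    ring
  simp_rw [hfd]
  rw [Finset.sum_sub_distrib, Finset.sum_add_distrib, ← Finset.mul_sum, ← lap_eq d φ hη.smooth,
    hη.poisson, mfield_div, ← ht]
  -- remainder terms
  have hb : ∑ i : Fin d, fderiv ℝ W x (EuclideanSpace.single i 1) *
      fderiv ℝ φ x (EuclideanSpace.single i 1) ≤ d * (C * M₁) * t ^ (-((ρ + 1) / 2)) := by
    calc _ ≤ ∑ i : Fin d, C * t ^ (-((ρ + 1) / 2)) * M₁ := by
          refine Finset.sum_le_sum fun i _ => ?_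
          refine (le_abs_self _).trans ?_
          rw [abs_mul]
          exact mul_le_mul (dW i) (dφ i) (abs_nonneg _) (by positivity)
      _ = _ := by simp; ring
  have hq : ∑ i : Fin d, (mfield d c s i x - W x * fderiv ℝ φ x (EuclideanSpace.single i 1)) ^ 2 ≤
      2 * (c ^ 2 * t ^ (-1 - s)) + 2 * (d * (C * M₁) ^ 2 * t ^ (-ρ)) := by
    have h2 : t ^ (-ρ) = (t ^ (-(ρ / 2))) ^ 2 := by
      rw [← Real.rpow_natCast (_ ^ (-(ρ / 2))), ← Real.rpow_mul hpos.le]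
      congr 1; push_cast; ring
    calc _ ≤ ∑ i : Fin d, (2 * mfield d c s i x ^ 2 + 2 * ((C * M₁) ^ 2 * t ^ (-ρ))) := by
          refine Finset.sum_le_sum fun i _ => ?_
          have h1 : |W x * fderiv ℝ φ x (EuclideanSpace.single i 1)| ≤
              C * t ^ (-(ρ / 2)) * M₁ := by
            rw [abs_mul]
            exact mul_le_mul bW (dφ i) (abs_nonneg _) (by positivity)
          have h3 : (W x * fderiv ℝ φ x (EuclideanSpace.single i 1)) ^ 2 ≤
              (C * M₁) ^ 2 * t ^ (-ρ) := by
            calc _ = |W x * fderiv ℝ φ x (EuclideanSpace.single i 1)| ^ 2 := (sq_abs _).symm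
              _ ≤ (C * t ^ (-(ρ / 2)) * M₁) ^ 2 := by gcongr
              _ = _ := by rw [h2]; ring
          nlinarith [sq_nonneg (mfield d c s i x + W x * fderiv ℝ φ x (EuclideanSpace.single i 1))]
      _ = 2 * ∑ i : Fin d, mfield d c s i x ^ 2 + 2 * (d * (C * M₁) ^ 2 * t ^ (-ρ)) := by
          rw [Finset.sum_add_distrib, ← Finset.mul_sum]
          simp
          ring
      _ ≤ _ := by
          have := mfield_sq d c s x
          rw [← ht] at this
          linarith
  have p1 : t ^ (-1 - s) = t ^ (-1 - s / 2) * t ^ (-(s / 2)) := by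
    rw [← Real.rpow_add hpos]; congr 1; ring
  have p2 : t ^ (-ρ) = t ^ (-1 - s / 2) * t ^ (-(ρ - 1 - s / 2)) := by
    rw [← Real.rpow_add hpos]; congr 1; ring
  have p3 : t ^ (-((ρ + 1) / 2)) = t ^ (-1 - s / 2) * t ^ (-((ρ - 1 - s) / 2)) := by
    rw [← Real.rpow_add hpos]; congr 1; ring
  rw [p1, p2] at hq
  rw [p3] at hb
  have p4 : 0 ≤ t ^ (-1 - s / 2) * ((2 + s) * t⁻¹) := by positivity
  have p5 : -(|c| * (t ^ (-1 - s / 2) * ((2 + s) * t⁻¹))) ≤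
      c * (t ^ (-1 - s / 2) * ((2 + s) * t⁻¹)) := by
    rw [← neg_mul]
    exact mul_le_mul_of_nonneg_right (neg_abs_le c) p4
  rw [← hc]
  linear_combination 2 * hq + hb + p5

/-- Theorem 3.1 (ii), case `ρ ∈ (1,2]`: finiteness of the discrete spectrum for vanishing
mean value. -/
theorem finite_discrete_spectrum_zero_mean
    (d : ℕ) (hd : 1 ≤ d) (ρ : ℝ) (hρ : ρ ∈ Set.Ioc (1 : ℝ) 2)
    (W : Ed d → ℝ) (hW : SClass d 2 ρ W)
    (η φ : Ed d → ℝ) (hη : IsAdmissible d η 0 φ) :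
    (⨆ E ∈ Set.Iio (0 : ℝ), schN d (fun x => η x * W x) E) < ⊤ := by
  obtain ⟨M, R, hM, hb⟩ := pointwise_bound d ρ hρ W hW η φ hη _ _ rfl rfl
  have hcont : Continuous (fun x => η x * W x) := by
    have h1 : η = lap d φ := by
      ext x
      rw [hη.poisson x, sub_zero]
    rw [h1]
    exact (lap_cont d φ hη.smooth).mul hW.1.continuous
  refine count_finite d _ hcont _ (fun i => ?_) M R hM hb
  refine (mfield_contDiff d _ _ i).sub ((hW.1.of_le (by norm_num)).mul ?_)
  exact (hη.smooth.fderiv_right (m := 1) (by norm_num)).clm_apply contDiff_const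

end
end
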